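/- arXiv:1009.0414 — 2 statements merged into one kernel-verified Lean document; each statement's English description precedes it below -/
import Mathlib

section
/- Let R'' = F_q[V_1, V_2, …, V_n] ⊆ S(V). Then (S(V)⊗Λ(V))^{U_n(q)} = R'' ⊕ ⨁_{j=1}^{n} ⨁_{m=j}^{n} ⨁_{0 ≤ b_1 < ⋯ < b_j = m−1} M_{m;b_1,…,b_j} · R'', a direct sum of R''-submodules; equivalently, (S(V)⊗Λ(V))^{U_n(q)} is a free R''-module with basis consisting of 1 together with the elements M_{m;b_1,…,b_j} for 1 ≤ j ≤ m ≤ n and 0 ≤ b_1 < ⋯ < b_j = m−1. In particular S(V)^{U_n(q)} = F_q[V_1, …, V_n]. -/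
open scoped TensorProduct
open MvPolynomial Finset

noncomputable section

/-- The symmetric algebra `S(V) = F[x_1,…,x_n]` of the natural module `V = F^n`. -/
abbrev SV (F : Type) [Field F] (n : ℕ) := MvPolynomial (Fin n) F

/-- The exterior algebra `Λ(V) = E[y_1,…,y_n]`. -/
abbrev LV (F : Type) [Field F] (n : ℕ) := ExteriorAlgebra F (Fin n → F)

/-- `S(V) ⊗ Λ(V)`. -/
abbrev SL (F : Type) [Field F] (n : ℕ) := SV F n ⊗[F] LV F n

/-- the variable `x_{a+1}` (0-indexed `a`), junk value `0` out of range. -/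
def xV (F : Type) [Field F] (n a : ℕ) : SV F n :=
  if h : a < n then X ⟨a, h⟩ else 0

/-- the exterior generator `y_{a+1}` (0-indexed `a`). -/
def yV (F : Type) [Field F] (n a : ℕ) : LV F n :=
  if h : a < n then ExteriorAlgebra.ι F (Pi.single (⟨a, h⟩ : Fin n) (1 : F)) else 0

/-- the product `y_{s_1} ⋯ y_{s_j}` over `S = {s_1 < ⋯ < s_j}` in increasing order. -/
def yProd (F : Type) [Field F] (n : ℕ) (S : Finset ℕ) : LV F n :=
  ((S.sort (· ≤ ·)).map (yV F n)).prod

/-- determinant of the matrix `(x_t^{q^c})` with rows indexed by `c ∈ R` in increasing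
order and columns by `t ∈ C` in increasing order; junk value `0` if sizes differ. -/
def subDet (F : Type) [Field F] (q n : ℕ) (R C : Finset ℕ) : SV F n :=
  if h : C.card = R.card then
    Matrix.det (Matrix.of fun i j : Fin R.card =>
      xV F n (C.orderEmbOfFin h j) ^ q ^ (R.orderEmbOfFin rfl i : ℕ))
  else 0

/-- Mui's element `M_{m;b_1,…,b_j}` where `B = {b_1 < ⋯ < b_j}` (0-indexed `b`'s);
for `B = ∅` this is the Moore determinant `det (x_t^{q^c})`. -/
def MuiM (F : Type) [Field F] (q n m : ℕ) (B : Finset ℕ) : SL F n :=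
  ∑ S ∈ (range m).powersetCard B.card,
    ((-1 : F) ^ (B.card * (B.card + 1) / 2 + (∑ s ∈ S, s) + B.card)) •
      (subDet F q n (range m \ B) (range m \ S) ⊗ₜ[F] yProd F n S)

/-- `∏_{c : F^a} (c_1 x_1 + ⋯ + c_a x_a + x_{t+1})` (0-indexed `t`). -/
def linProd (F : Type) [Field F] [Fintype F] (n a t : ℕ) : SV F n :=
  ∏ c : Fin a → F, ((∑ k : Fin a, MvPolynomial.C (c k) * xV F n k) + xV F n t)

/-- Dickson's `L_m = V_1 V_2 ⋯ V_m`. -/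
def Lm (F : Type) [Field F] [Fintype F] (n m : ℕ) : SV F n :=
  ∏ a ∈ range m, linProd F n a a

/-- The property characterizing the Dickson invariants `Q_{m,k}`:
`Q_{m,k} · L_m = L_{m,k}` in `F[x_1,…,x_m]`. -/
def DicksonProp (F : Type) [Field F] [Fintype F] (q : ℕ)
    (Q : (m : ℕ) → ℕ → SV F m) : Prop :=
  ∀ m k : ℕ, k ≤ m →
    Q m k * Lm F m m = subDet F q m (range (m + 1) \ {k}) (range m)

/-- action of a matrix on `S(V)` by linear substitution: `x_j ↦ ∑_i g_{ij} x_i`. -/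
def gAct (F : Type) [Field F] (n : ℕ) (g : Matrix (Fin n) (Fin n) F) :
    SV F n →ₐ[F] SV F n :=
  MvPolynomial.aeval fun j => ∑ i, MvPolynomial.C (g i j) * MvPolynomial.X i

/-- action of a matrix on `Λ(V)` by linear substitution: `y_j ↦ ∑_i g_{ij} y_i`. -/
def eAct (F : Type) [Field F] (n : ℕ) (g : Matrix (Fin n) (Fin n) F) :
    LV F n →ₐ[F] LV F n :=
  ExteriorAlgebra.map g.mulVecLin

/-- diagonal action of a matrix on `S(V) ⊗ Λ(V)`. -/
def tAct (F : Type) [Field F] (n : ℕ) (g : Matrix (Fin n) (Fin n) F) :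
    SL F n →ₐ[F] SL F n :=
  Algebra.TensorProduct.map (gAct F n g) (eAct F n g)

/-- the invariants of a set of matrices on `S(V) ⊗ Λ(V)`, as an `F`-subspace. -/
def invSL (F : Type) [Field F] (n : ℕ) (P : Set (Matrix (Fin n) (Fin n) F)) :
    Submodule F (SL F n) where
  carrier := {f | ∀ g ∈ P, tAct F n g f = f}
  add_mem' := fun ha hb g hg => by rw [map_add, ha g hg, hb g hg]
  zero_mem' := fun g hg => map_zero _
  smul_mem' := fun c f hf g hg => by rw [map_smul, hf g hg]

/-- the invariants of `S(V) ⊗ Λ(V) ⊗ Det^k`, i.e. elements with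
`det(g)^k (g·f) = f` for all `g ∈ P`. -/
def invSLtw (F : Type) [Field F] (n k : ℕ) (P : Set (Matrix (Fin n) (Fin n) F)) :
    Submodule F (SL F n) where
  carrier := {f | ∀ g ∈ P, g.det ^ k • tAct F n g f = f}
  add_mem' := fun ha hb g hg => by rw [map_add, smul_add, ha g hg, hb g hg]
  zero_mem' := fun g hg => by rw [map_zero, smul_zero]
  smul_mem' := fun c f hf g hg => by rw [map_smul, smul_comm, hf g hg]

/-- the invariants of a set of matrices on `S(V)`, as an `F`-subalgebra. -/
def invS (F : Type) [Field F] (n : ℕ) (P : Set (Matrix (Fin n) (Fin n) F)) :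
    Subalgebra F (SV F n) where
  carrier := {f | ∀ g ∈ P, gAct F n g f = f}
  mul_mem' := fun ha hb g hg => by rw [map_mul, ha g hg, hb g hg]
  one_mem' := fun g hg => map_one _
  add_mem' := fun ha hb g hg => by rw [map_add, ha g hg, hb g hg]
  zero_mem' := fun g hg => map_zero _
  algebraMap_mem' := fun c g hg => (gAct F n g).commutes c

/-- `v_{i,j+1}` (0-indexed `j`) for the composition `I`. -/
def vij (F : Type) [Field F] [Fintype F] (n : ℕ) (I : Composition n)
    (i : Fin I.length) (j : ℕ) : SV F n :=
  linProd F n (I.sizeUpTo i) (I.sizeUpTo i + j)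

/-- `θ_i = L_{n_i}(v_{i,1},…,v_{i,n_i})`. -/
def theta (F : Type) [Field F] [Fintype F] (n : ℕ) (I : Composition n)
    (i : Fin I.length) : SV F n :=
  MvPolynomial.aeval (fun t : Fin (I.blocksFun i) => vij F n I i t)
    (Lm F (I.blocksFun i) (I.blocksFun i))

/-- `q_{i,k} = Q_{n_i,k}(v_{i,1},…,v_{i,n_i})`, given the Dickson polynomials `Q`. -/
def qInv (F : Type) [Field F] [Fintype F] (n : ℕ) (Q : (m : ℕ) → ℕ → SV F m)
    (I : Composition n) (i : Fin I.length) (k : ℕ) : SV F n :=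
  MvPolynomial.aeval (fun t : Fin (I.blocksFun i) => vij F n I i t)
    (Q (I.blocksFun i) k)

/-- the index of the block (0-indexed) of the composition `I` containing `a`. -/
def blkIdx (n : ℕ) (I : Composition n) (a : ℕ) : ℕ :=
  ((range I.length).filter fun i => I.sizeUpTo (i + 1) ≤ a).card

/-- the parabolic subgroup `P_I`: invertible block upper-triangular matrices. -/
def PIset (F : Type) [Field F] (n : ℕ) (I : Composition n) :
    Set (Matrix (Fin n) (Fin n) F) :=
  {g | IsUnit g.det ∧ ∀ a b : Fin n, blkIdx n I b < blkIdx n I a → g a b = 0}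

/-- the subgroup `K_I ≤ P_I`: block upper-triangular with all diagonal blocks
of determinant `1`. -/
def KIset (F : Type) [Field F] (n : ℕ) (I : Composition n) :
    Set (Matrix (Fin n) (Fin n) F) :=
  {g | IsUnit g.det ∧ (∀ a b : Fin n, blkIdx n I b < blkIdx n I a → g a b = 0) ∧
    ∀ i : Fin I.length,
      Matrix.det (Matrix.of fun a b : Fin (I.blocksFun i) =>
        g (I.embedding i a) (I.embedding i b)) = 1}

/-- the unipotent subgroup `U_n` of uni-uppertriangular matrices. -/
def Uset (F : Type) [Field F] (n : ℕ) : Set (Matrix (Fin n) (Fin n) F) :=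
  {g | (∀ a b : Fin n, b < a → g a b = 0) ∧ ∀ a : Fin n, g a a = 1}

/-- `SL_n(q)`. -/
def SLset (F : Type) [Field F] (n : ℕ) : Set (Matrix (Fin n) (Fin n) F) :=
  {g | g.det = 1}

/-- `GL_n(q)`. -/
def GLset (F : Type) [Field F] (n : ℕ) : Set (Matrix (Fin n) (Fin n) F) :=
  {g | IsUnit g.det}

/-- the bigraded piece `S^i(V) ⊗ Λ^j(V)` of `S(V) ⊗ Λ(V)`. -/
def piece (F : Type) [Field F] (n i j : ℕ) : Submodule F (SL F n) :=
  LinearMap.range (TensorProduct.map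
    (MvPolynomial.homogeneousSubmodule (Fin n) F i).subtype
    (LinearMap.range (ExteriorAlgebra.ι F (M := Fin n → F)) ^ j).subtype)

/-- the Hilbert series in `ℤ[s][[t]]` of a bigraded subspace `W` of `S(V) ⊗ Λ(V)`:
the coefficient of `t^i` is `∑_{j=0}^n dim (W ∩ (S^i ⊗ Λ^j)) s^j`. -/
def Hser (F : Type) [Field F] (n : ℕ) (W : Submodule F (SL F n)) :
    PowerSeries (Polynomial ℤ) :=
  PowerSeries.mk fun i => ∑ j ∈ range (n + 1),
    Polynomial.C (Module.finrank F ↥(W ⊓ piece F n i j) : ℤ) * Polynomial.X ^ j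

/-- the Hilbert series in `ℤ[[t]]` of a graded subalgebra of `S(V)`. -/
def HserS (F : Type) [Field F] (n : ℕ) (W : Subalgebra F (SV F n)) :
    PowerSeries ℤ :=
  PowerSeries.mk fun d =>
    (Module.finrank F ↥(Subalgebra.toSubmodule W ⊓ MvPolynomial.homogeneousSubmodule (Fin n) F d) : ℤ)

/-- the index set for Mui-type basis elements attached to the composition `I`:
pairs `(i, B)` with `B = {b_1 < ⋯ < b_j} ⊆ {0,…,m_{i+1}−1}` nonempty and
`max B ≥ m_i` (0-indexed `i`). -/
def Adm (n : ℕ) (I : Composition n) : Finset (Fin I.length × Finset ℕ) :=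
  (Finset.univ ×ˢ (range n).powerset).filter fun x =>
    x.2 ⊆ range (I.sizeUpTo ((x.1 : ℕ) + 1)) ∧ x.2.Nonempty ∧ ∃ b ∈ x.2, I.sizeUpTo (x.1 : ℕ) ≤ b

section Contraction

variable {F : Type} [Field F] {n : ℕ}

/-- The degree-one element `1 ⊗ v` of `S(V) ⊗ Λ(V)`. -/
def extVec (v : Fin n → F) : SL F n := 1 ⊗ₜ ExteriorAlgebra.ι F v

/-- The value at `v` of the `S(V)`-valued linear form on `V` with coordinates `w`. -/
def pairing (w : Fin n → SV F n) (v : Fin n → F) : SV F n := ∑ s, v s • w s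

/-- Contraction of `S(V) ⊗ Λ(V)` by the `S(V)`-valued linear form with coordinates `w`. -/
def contr (w : Fin n → SV F n) : Module.End (SV F n) (SL F n) :=
  ∑ s, w s • (CliffordAlgebra.contractLeft (Q := (0 : QuadraticForm F (Fin n → F)))
    (LinearMap.proj s)).baseChange (SV F n)

/-- Projection of `S(V) ⊗ Λ(V)` onto its part of exterior degree zero. -/
def scalarPart (F : Type) [Field F] (n : ℕ) : SL F n →ₐ[SV F n] SV F n :=
  Algebra.TensorProduct.lift (Algebra.ofId (SV F n) (SV F n))
    ((Algebra.ofId F (SV F n)).comp ExteriorAlgebra.algebraMapInv) fun _ _ => Commute.all _ _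

theorem SL_induction {P : SL F n → Prop} (scalar : ∀ p : SV F n, P (p ⊗ₜ 1))
    (add : ∀ f g, P f → P g → P (f + g)) (vec_mul : ∀ v f, P f → P (extVec v * f)) (f : SL F n) :
    P f := by
  induction f using TensorProduct.induction_on with
  | zero => simpa using scalar 0
  | add f g hf hg => exact add f g hf hg
  | tmul p ω =>
    induction ω using CliffordAlgebra.left_induction generalizing p with
    | algebraMap r =>
      have := scalar (r • p)
      rwa [TensorProduct.smul_tmul, ← Algebra.algebraMap_eq_smul_one] at this
    | add x y hx hy => rw [TensorProduct.tmul_add]; exact add _ _ (hx p) (hy p)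
    | ι_mul x m hx =>
      have := vec_mul m _ (hx p)
      rwa [extVec, Algebra.TensorProduct.tmul_mul_tmul, one_mul] at this

theorem extVec_add (v v' : Fin n → F) : extVec (v + v') = extVec v + extVec v' := by
  simp [extVec, TensorProduct.tmul_add]

theorem extVec_smul (c : F) (v : Fin n → F) : extVec (c • v) = c • extVec v := by
  simp [extVec]

theorem extVec_mul_self (v : Fin n → F) : extVec v * extVec v = 0 := by
  simp [extVec]

theorem extVec_mul_swap (v v' : Fin n → F) : extVec v * extVec v' = -(extVec v' * extVec v) := by
  have := ExteriorAlgebra.ι_add_mul_swap (R := F) v v'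
  rw [eq_neg_iff_add_eq_zero, extVec, extVec, Algebra.TensorProduct.tmul_mul_tmul,
    Algebra.TensorProduct.tmul_mul_tmul, ← TensorProduct.tmul_add, this, TensorProduct.tmul_zero]

theorem pairing_single (w : Fin n → SV F n) (s : Fin n) : pairing w (Pi.single s 1) = w s := by
  simp [pairing, Pi.single_apply]

theorem tmul_one_mul (p : SV F n) (f : SL F n) : (p ⊗ₜ[F] (1 : LV F n)) * f = p • f := by
  induction f using TensorProduct.induction_on with
  | zero => simp
  | add f g hf hg => rw [mul_add, hf, hg, smul_add]
  | tmul r ω => rw [Algebra.TensorProduct.tmul_mul_tmul, one_mul, TensorProduct.smul_tmul',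
      smul_eq_mul]

theorem contr_scalar (w : Fin n → SV F n) (p : SV F n) : contr w (p ⊗ₜ 1) = 0 := by
  simp [contr, LinearMap.sum_apply, LinearMap.baseChange_tmul,
    CliffordAlgebra.contractLeft_one]

theorem contr_extVec_mul (w : Fin n → SV F n) (v : Fin n → F) (f : SL F n) :
    contr w (extVec v * f) = pairing w v • f - extVec v * contr w f := by
  induction f using TensorProduct.induction_on with
  | zero => simp
  | add f g hf hg => rw [mul_add, map_add, hf, hg, map_add, mul_add, smul_add]; abel
  | tmul p ω =>
    have key (s : Fin n) : CliffordAlgebra.contractLeft (Q := (0 : QuadraticForm F (Fin n → F)))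
        (LinearMap.proj s) (ExteriorAlgebra.ι F v * ω) = v s • ω - ExteriorAlgebra.ι F v *
          CliffordAlgebra.contractLeft (Q := (0 : QuadraticForm F (Fin n → F)))
            (LinearMap.proj s) ω := CliffordAlgebra.contractLeft_ι_mul _ _ _
    simp only [extVec, contr, LinearMap.sum_apply, LinearMap.smul_apply,
      LinearMap.baseChange_tmul, Algebra.TensorProduct.tmul_mul_tmul, one_mul, key, pairing,
      TensorProduct.tmul_sub, smul_sub, Finset.sum_sub_distrib, Finset.sum_smul, Finset.mul_sum,
      TensorProduct.smul_tmul', smul_eq_mul]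
    congr 1
    refine Finset.sum_congr rfl fun s _ => ?_
    rw [TensorProduct.tmul_smul, TensorProduct.smul_tmul', smul_mul_assoc]

theorem contr_add (w w' : Fin n → SV F n) : contr (w + w') = contr w + contr w' := by
  simp [contr, add_smul, Finset.sum_add_distrib]

theorem contr_smul (p : SV F n) (w : Fin n → SV F n) : contr (p • w) = p • contr w := by
  simp [contr, mul_smul, Finset.smul_sum]

theorem contr_sum {ι : Type*} (s : Finset ι) (w : ι → Fin n → SV F n) :
    contr (∑ i ∈ s, w i) = ∑ i ∈ s, contr (w i) := by
  exact map_sum (AddMonoidHom.mk' (contr (F := F) (n := n)) contr_add) w s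

theorem contr_contr_self (w : Fin n → SV F n) (f : SL F n) : contr w (contr w f) = 0 := by
  induction f using SL_induction with
  | scalar p => simp [contr_scalar]
  | add f g hf hg => simp [hf, hg]
  | vec_mul v f hf => rw [contr_extVec_mul, map_sub, map_smul, contr_extVec_mul, hf]; simp

theorem contr_contr_swap (w w' : Fin n → SV F n) (f : SL F n) :
    contr w (contr w' f) = -contr w' (contr w f) := by
  have := contr_contr_self (w + w') f
  simp only [contr_add, LinearMap.add_apply, map_add, contr_contr_self, zero_add, add_zero] at this
  rwa [eq_neg_iff_add_eq_zero, add_comm]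

theorem contr_mul_self (w : Fin n → SV F n) : contr w * contr w = 0 :=
  LinearMap.ext (contr_contr_self w)

theorem contr_mul_swap (w w' : Fin n → SV F n) : contr w * contr w' = -(contr w' * contr w) :=
  LinearMap.ext (contr_contr_swap w w')

@[simp]
theorem scalarPart_scalar (p : SV F n) : scalarPart F n (p ⊗ₜ 1) = p := by
  simp [scalarPart, Algebra.ofId_apply]

@[simp]
theorem scalarPart_extVec_mul (v : Fin n → F) (f : SL F n) :
    scalarPart F n (extVec v * f) = 0 := by
  have : scalarPart F n (extVec v) = 0 := by
    simp [scalarPart, extVec, ExteriorAlgebra.algebraMapInv, Algebra.ofId_apply]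
  rw [map_mul, this, zero_mul]

theorem eq_scalarPart_tmul_of_contr_eq_zero (f : SL F n)
    (h : ∀ s, contr (Pi.single s 1) f = 0) : f = scalarPart F n f ⊗ₜ 1 := by
  let proj (s : Fin n) : SL F n → SL F n := fun g =>
    contr (Pi.single s 1) (extVec (Pi.single s 1) * g)
  have proj_eq (s : Fin n) (g : SL F n) : proj s g =
      g - extVec (Pi.single s 1) * contr (Pi.single s 1) g := by
    simp [proj, contr_extVec_mul, pairing_single]
  have proj_add (s : Fin n) (g g' : SL F n) : proj s (g + g') = proj s g + proj s g' := by
    simp [proj, mul_add]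
  have proj_vec (r s : Fin n) (g : SL F n) :
      ∃ g', proj s (extVec (Pi.single r 1) * g) = extVec (Pi.single r 1) * g' := by
    by_cases hrs : r = s
    · subst hrs
      exact ⟨0, by simp [proj, ← mul_assoc, extVec_mul_self]⟩
    · refine ⟨proj s g, ?_⟩
      rw [proj_eq, proj_eq, contr_extVec_mul]
      have : pairing (F := F) (Pi.single s 1 : Fin n → SV F n) (Pi.single r 1) = 0 := by
        rw [pairing_single, Pi.single_apply, if_neg hrs]
      have swap : extVec (Pi.single s 1) * (extVec (Pi.single r 1) * contr (Pi.single s 1) g) =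
          -(extVec (Pi.single r 1) * (extVec (Pi.single s 1) * contr (Pi.single s 1) g)) := by
        rw [← mul_assoc, extVec_mul_swap, ← mul_assoc]
        exact neg_mul (extVec (Pi.single r (1 : F)) * extVec (Pi.single s (1 : F))) _
      rw [this, zero_smul, mul_sub, mul_zero, swap, mul_sub]
      abel
  let projs (l : List (Fin n)) : SL F n → SL F n := fun g => l.foldr proj g
  have projs_add (l : List (Fin n)) (g g' : SL F n) :
      projs l (g + g') = projs l g + projs l g' := by
    induction l with
    | nil => rfl
    | cons a l ih => exact (congrArg (proj a) ih).trans (proj_add _ _ _)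
  have projs_vec (l : List (Fin n)) (r : Fin n) (g : SL F n) :
      ∃ g', projs l (extVec (Pi.single r 1) * g) = extVec (Pi.single r 1) * g' := by
    induction l with
    | nil => exact ⟨g, rfl⟩
    | cons a l ih =>
      obtain ⟨g', hg'⟩ := ih
      obtain ⟨g'', hg''⟩ := proj_vec r a g'
      exact ⟨g'', (congrArg (proj a) hg').trans hg''⟩
  have projs_zero (l : List (Fin n)) : projs l 0 = 0 := by
    simpa using projs_add l 0 0
  have projs_kill (l : List (Fin n)) (r : Fin n) (hr : r ∈ l) (g : SL F n) :
      projs l (extVec (Pi.single r 1) * g) = 0 := by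
    induction l with
    | nil => simp at hr
    | cons a l ih =>
      by_cases har : r = a
      · subst har
        obtain ⟨g', hg'⟩ := projs_vec l r g
        refine (congrArg (proj r) hg').trans ?_
        simp [proj, ← mul_assoc, extVec_mul_self]
      · have hl := ih ((List.mem_cons.1 hr).resolve_left har)
        refine (congrArg (proj a) hl).trans ?_
        simp [proj]
  have projs_fix (l : List (Fin n)) : projs l f = f := by
    induction l with
    | nil => rfl
    | cons a l ih => exact (congrArg (proj a) ih).trans (by rw [proj_eq, h]; simp)
  have projs_scalar (l : List (Fin n)) (p : SV F n) : projs l (p ⊗ₜ 1) = p ⊗ₜ 1 := by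
    induction l with
    | nil => rfl
    | cons a l ih => exact (congrArg (proj a) ih).trans (by rw [proj_eq, contr_scalar]; simp)
  have full (g : SL F n) : projs (List.finRange n) g = scalarPart F n g ⊗ₜ 1 := by
    induction g using SL_induction with
    | scalar p => rw [projs_scalar, scalarPart_scalar]
    | add g g' hg hg' => rw [projs_add, hg, hg', map_add, TensorProduct.add_tmul]
    | vec_mul v g hg =>
      have hv : v = ∑ r, v r • (Pi.single r 1 : Fin n → F) := by
        simpa using (pi_eq_sum_univ' v)
      have hext : extVec v * g = ∑ r, extVec (Pi.single r 1) * (v r • g) := by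
        conv_lhs => rw [hv]
        have := map_sum (AddMonoidHom.mk' (extVec (F := F) (n := n)) extVec_add)
          (fun r => v r • (Pi.single r 1 : Fin n → F)) univ
        simp only [AddMonoidHom.mk'_apply] at this
        rw [this, Finset.sum_mul]
        refine Finset.sum_congr rfl fun r _ => ?_
        rw [extVec_smul, smul_mul_assoc, mul_smul_comm]
      have hsum := map_sum (AddMonoidHom.mk' (projs (List.finRange n)) (projs_add _))
        (fun r => extVec (Pi.single r 1) * (v r • g)) univ
      simp only [AddMonoidHom.mk'_apply] at hsum
      rw [scalarPart_extVec_mul, TensorProduct.zero_tmul, hext, hsum]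
      exact Finset.sum_eq_zero fun r _ => projs_kill _ _ (List.mem_finRange r) _
  rw [← full, projs_fix]

theorem eq_zero_of_scalarPart_contr_eq_zero (f : SL F n)
    (h : ∀ L : List (Fin n),
      scalarPart F n ((L.map fun s => contr (Pi.single s 1)).prod f) = 0) : f = 0 := by
  suffices H : ∀ k : ℕ, ∀ f : SL F n, (∀ s : Fin n, k ≤ s → contr (Pi.single s 1) f = 0) →
      (∀ L : List (Fin n), scalarPart F n ((L.map fun s => contr (Pi.single s 1)).prod f) = 0) →
      f = 0 from H n f (fun s hs => absurd s.2 (not_lt.2 hs)) h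
  intro k
  induction k with
  | zero =>
    intro f hf hL
    rw [eq_scalarPart_tmul_of_contr_eq_zero f fun s => hf s (Nat.zero_le _)]
    have : scalarPart F n f = 0 := by simpa using hL []
    simp [this]
  | succ k ih =>
    intro f hf hL
    refine ih f (fun s hs => ?_) hL
    rcases Nat.lt_or_ge k s with hks | hks
    · exact hf s hks
    · refine ih _ (fun r hr => ?_) fun L => ?_
      · by_cases hrs : r = s
        · rw [hrs, contr_contr_self]
        · rw [contr_contr_swap, hf r, map_zero, neg_zero]
          have : (r : ℕ) ≠ s := fun h => hrs (Fin.ext h)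
          omega
      · simpa using hL (L ++ [s])

end Contraction

section ContractionList

variable {F : Type} [Field F] {n : ℕ}

/-- Composite of the contractions by the forms `w i`, for `i` running through a list. -/
def contrList (w : ℕ → Fin n → SV F n) (L : List ℕ) : Module.End (SV F n) (SL F n) :=
  (L.map fun i => contr (w i)).prod

theorem contrList_nil (w : ℕ → Fin n → SV F n) : contrList w [] = 1 := rfl

theorem contrList_cons (w : ℕ → Fin n → SV F n) (i : ℕ) (L : List ℕ) :
    contrList w (i :: L) = contr (w i) * contrList w L := by
  simp [contrList]

theorem contrList_append (w : ℕ → Fin n → SV F n) (L L' : List ℕ) :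
    contrList w (L ++ L') = contrList w L * contrList w L' := by
  simp [contrList]

theorem end_mul_neg (a b : Module.End (SV F n) (SL F n)) : a * -b = -(a * b) :=
  LinearMap.ext fun f => map_neg a (b f)

theorem end_neg_mul (a b : Module.End (SV F n) (SL F n)) : -a * b = -(a * b) := rfl

theorem end_neg_neg (a : Module.End (SV F n) (SL F n)) : - -a = a :=
  LinearMap.ext fun f => neg_neg (a f)

theorem contrList_perm (w : ℕ → Fin n → SV F n) {L L' : List ℕ} (h : L.Perm L') :
    contrList w L = contrList w L' ∨ contrList w L = -contrList w L' := by
  induction h with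
  | nil => exact Or.inl rfl
  | cons x _ ih =>
    rw [contrList_cons, contrList_cons]
    rcases ih with ih | ih
    · exact Or.inl (by rw [ih])
    · exact Or.inr (by rw [ih, end_mul_neg])
  | swap x y l =>
    right
    simp only [contrList_cons, ← mul_assoc]
    rw [contr_mul_swap, end_neg_mul]
  | trans _ _ ih ih' =>
    rcases ih with ih | ih <;> rcases ih' with ih' | ih' <;>
      simp [ih, ih', end_neg_neg]

theorem contrList_eq_zero_of_not_nodup (w : ℕ → Fin n → SV F n) {L : List ℕ} (h : ¬ L.Nodup) :
    contrList w L = 0 := by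
  induction L with
  | nil => simp at h
  | cons a l ih =>
    rw [List.nodup_cons, not_and_or, not_not] at h
    rcases h with h | h
    · have hp := contrList_perm w (List.perm_cons_erase h)
      rw [contrList_cons] at hp ⊢
      rcases hp with hp | hp
      · rw [hp, ← mul_assoc, contr_mul_self, zero_mul]
      · rw [hp, end_mul_neg, ← mul_assoc, contr_mul_self, zero_mul]
        exact LinearMap.ext fun f => neg_zero
    · rw [contrList_cons, ih h, mul_zero]

/-- Composite of the contractions by the forms `w i`, for `i` increasing through a finset. -/
def contrSet (w : ℕ → Fin n → SV F n) (B : Finset ℕ) : Module.End (SV F n) (SL F n) :=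
  contrList w (B.sort (· ≤ ·))

theorem contrList_eq_contrSet (w : ℕ → Fin n → SV F n) (L : List ℕ) :
    contrList w L = 0 ∨ contrList w L = contrSet w L.toFinset ∨
      contrList w L = -contrSet w L.toFinset := by
  by_cases h : L.Nodup
  · refine Or.inr (contrList_perm w ?_)
    refine (List.perm_of_nodup_nodup_toFinset_eq h (Finset.sort_nodup _ _) ?_)
    simp
  · exact Or.inl (contrList_eq_zero_of_not_nodup w h)

/-- An element killed by the last `n - k` coordinate contractions is determined by the
scalar parts of its contractions by `k` linear forms with nonzero determinant. -/
theorem eq_zero_of_scalarPart_contrList_eq_zero (k : ℕ) (hk : k ≤ n) (w : ℕ → Fin n → SV F n)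
    (hdet : (Matrix.of fun i j : Fin k => w i (Fin.castLE hk j)).det ≠ 0) (f : SL F n)
    (hf : ∀ s : Fin n, k ≤ s → contr (Pi.single s 1) f = 0)
    (h : ∀ L : List ℕ, (∀ i ∈ L, i < k) → scalarPart F n (contrList w L f) = 0) : f = 0 := by
  let Z : Submodule (SV F n) (SL F n) :=
    { carrier := {a | (∀ s : Fin n, k ≤ s → contr (Pi.single s 1) a = 0) ∧
        ∀ L : List ℕ, (∀ i ∈ L, i < k) → scalarPart F n (contrList w L a) = 0}
      add_mem' := fun {a b} ha hb => ⟨fun s hs => by rw [map_add, ha.1 s hs, hb.1 s hs, add_zero],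
        fun L hL => by rw [map_add, map_add, ha.2 L hL, hb.2 L hL, add_zero]⟩
      zero_mem' := ⟨fun s _ => map_zero _, fun L _ => by simp⟩
      smul_mem' := fun c a ha => ⟨fun s hs => by rw [map_smul, ha.1 s hs, smul_zero],
        fun L hL => by rw [map_smul, map_smul, ha.2 L hL, smul_zero]⟩ }
  have hw : ∀ i < k, ∀ a ∈ Z, contr (w i) a ∈ Z := fun i hi a ha =>
    ⟨fun s hs => by rw [contr_contr_swap, ha.1 s hs, map_zero, neg_zero], fun L hL => by
      have := ha.2 (L ++ [i]) (by
        intro j hj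
        rcases List.mem_append.1 hj with hj | hj
        · exact hL j hj
        · rw [List.mem_singleton.1 hj]; exact hi)
      rwa [contrList_append, contrList_cons, contrList_nil, mul_one, Module.End.mul_apply] at this⟩
  set M : Matrix (Fin k) (Fin k) (SV F n) := Matrix.of fun i j => w i (Fin.castLE hk j) with hM
  have hs : ∀ s : Fin n, ∀ a ∈ Z, contr (Pi.single s 1) a ∈ Z := by
    intro s a ha
    rcases Nat.lt_or_ge s k with hsk | hsk
    · have hcramer : ∑ i : Fin k, M.adjugate ⟨s, hsk⟩ i • contr (w i) a =
          M.det • contr (Pi.single s 1) a := by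
        have hwi (i : Fin k) : contr (w i) a =
            ∑ j : Fin k, M i j • contr (Pi.single (Fin.castLE hk j) 1) a := by
          have hdec : w i = ∑ r : Fin n, w i r • (Pi.single r 1 : Fin n → SV F n) := by
            simpa using pi_eq_sum_univ' (w i)
          conv_lhs => rw [hdec, contr_sum, LinearMap.sum_apply]
          have himg : ∀ r : Fin n, r ∉ univ.map (Fin.castLEEmb hk) →
              (contr (w i r • (Pi.single r 1 : Fin n → SV F n))) a = 0 := by
            intro r hr
            have hkr : k ≤ r := by
              by_contra hlt
              exact hr (Finset.mem_map.2 ⟨⟨r, not_le.1 hlt⟩, mem_univ _, rfl⟩)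
            rw [contr_smul, LinearMap.smul_apply, ha.1 r hkr, smul_zero]
          rw [← Finset.sum_subset (Finset.subset_univ (univ.map (Fin.castLEEmb hk)))
            fun r _ hr => himg r hr, Finset.sum_map]
          refine Finset.sum_congr rfl fun j _ => ?_
          rw [contr_smul]; rfl
        simp_rw [hwi, Finset.smul_sum, smul_smul]
        rw [Finset.sum_comm]
        simp_rw [← Finset.sum_smul]
        have hadj (j : Fin k) : ∑ i, M.adjugate ⟨s, hsk⟩ i * M i j =
            if (⟨s, hsk⟩ : Fin k) = j then M.det else 0 := by
          rw [← Matrix.mul_apply, Matrix.adjugate_mul, Matrix.smul_apply, Matrix.one_apply]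
          split_ifs <;> simp
        simp_rw [hadj, ite_smul, zero_smul]
        rw [Finset.sum_ite_eq, if_pos (mem_univ _)]
        rfl
      have hmem : M.det • contr (Pi.single s 1) a ∈ Z := by
        rw [← hcramer]
        exact Submodule.sum_mem _ fun i _ => Z.smul_mem _ (hw i i.2 a ha)
      refine ⟨fun r hr => by rw [contr_contr_swap, ha.1 r hr, map_zero, neg_zero], fun L hL => ?_⟩
      have := hmem.2 L hL
      rw [map_smul, map_smul, smul_eq_mul] at this
      exact (mul_eq_zero.1 this).resolve_left hdet
    · rw [ha.1 s hsk]; exact Z.zero_mem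
  refine eq_zero_of_scalarPart_contr_eq_zero f fun L => ?_
  have hZ : (L.map fun s => contr (Pi.single s 1)).prod f ∈ Z := by
    induction L with
    | nil => exact ⟨hf, h⟩
    | cons a l ih => rw [List.map_cons, List.prod_cons]; exact hs a _ ih
  exact hZ.2 [] (by simp)

/-- The ring endomorphism of `S(V) ⊗ Λ(V)` induced by an endomorphism of `S(V)` and a linear
endomorphism of `V`. -/
def twist (σ : SV F n →ₐ[F] SV F n) (A : (Fin n → F) →ₗ[F] (Fin n → F)) : SL F n →ₐ[F] SL F n :=
  Algebra.TensorProduct.map σ (ExteriorAlgebra.map A)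

variable (σ : SV F n →ₐ[F] SV F n) (A : (Fin n → F) →ₗ[F] (Fin n → F))

theorem twist_scalar (p : SV F n) : twist σ A (p ⊗ₜ 1) = σ p ⊗ₜ 1 := by
  simp [twist]

theorem twist_extVec (v : Fin n → F) : twist σ A (extVec v) = extVec (A v) := by
  simp [twist, extVec]

theorem twist_smul (p : SV F n) (f : SL F n) : twist σ A (p • f) = σ p • twist σ A f := by
  rw [← tmul_one_mul, map_mul, twist_scalar, tmul_one_mul]

theorem scalarPart_twist (f : SL F n) :
    scalarPart F n (twist σ A f) = σ (scalarPart F n f) := by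
  induction f using SL_induction with
  | scalar p => rw [twist_scalar, scalarPart_scalar, scalarPart_scalar]
  | add f g hf hg => simp only [map_add, hf, hg]
  | vec_mul v f hf =>
    rw [map_mul, twist_extVec, scalarPart_extVec_mul, scalarPart_extVec_mul, map_zero]

theorem twist_contr {w w' : Fin n → SV F n}
    (h : ∀ v, σ (pairing w v) = pairing w' (A v)) (f : SL F n) :
    twist σ A (contr w f) = contr w' (twist σ A f) := by
  induction f using SL_induction with
  | scalar p => rw [twist_scalar, contr_scalar, contr_scalar, map_zero]
  | add f g hf hg => simp only [map_add, hf, hg]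
  | vec_mul v f hf =>
    rw [contr_extVec_mul, map_sub, twist_smul, map_mul, map_mul, twist_extVec, contr_extVec_mul,
      hf, h]

theorem twist_contrList {w w' : ℕ → Fin n → SV F n}
    (h : ∀ i v, σ (pairing (w i) v) = pairing (w' i) (A v)) (L : List ℕ) (f : SL F n) :
    twist σ A (contrList w L f) = contrList w' L (twist σ A f) := by
  induction L with
  | nil => rfl
  | cons a l ih =>
    rw [contrList_cons, contrList_cons, Module.End.mul_apply, Module.End.mul_apply,
      twist_contr σ A (h a), ih]

end ContractionList

section Unitriangular

variable {F : Type} [Field F] {n : ℕ}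

/-- The linear form `∑ v_s x_s`. -/
def linForm (v : Fin n → F) : SV F n := pairing (fun s => X s) v

theorem linForm_eq (v : Fin n → F) : linForm v = ∑ s, C (v s) * X s := by
  simp [linForm, pairing, MvPolynomial.smul_eq_C_mul]

theorem linForm_single (s : Fin n) : linForm (Pi.single s 1 : Fin n → F) = X s :=
  pairing_single _ s

theorem gAct_X (g : Matrix (Fin n) (Fin n) F) (j : Fin n) :
    gAct F n g (X j) = ∑ i, C (g i j) * X i := by
  simp [gAct]

theorem gAct_linForm (g : Matrix (Fin n) (Fin n) F) (v : Fin n → F) :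
    gAct F n g (linForm v) = linForm (g.mulVec v) := by
  rw [linForm_eq, linForm_eq, map_sum]
  simp only [map_mul, gAct_X, Matrix.mulVec, dotProduct, map_sum, Finset.mul_sum, Finset.sum_mul]
  rw [Finset.sum_comm]
  refine Finset.sum_congr rfl fun i _ => Finset.sum_congr rfl fun j _ => ?_
  rw [← MvPolynomial.algebraMap_eq, AlgHom.commutes]
  simp only [MvPolynomial.algebraMap_eq]
  ring

theorem gAct_gAct (g h : Matrix (Fin n) (Fin n) F) (p : SV F n) :
    gAct F n g (gAct F n h p) = gAct F n (g * h) p := by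
  have : (gAct F n g).comp (gAct F n h) = gAct F n (g * h) := by
    refine MvPolynomial.algHom_ext fun i => ?_
    rw [AlgHom.comp_apply, ← linForm_single, gAct_linForm, gAct_linForm, gAct_linForm,
      Matrix.mulVec_mulVec]
  rw [← this]; rfl

theorem gAct_one (p : SV F n) : gAct F n 1 p = p := by
  have : gAct F n 1 = AlgHom.id F (SV F n) := by
    refine MvPolynomial.algHom_ext fun i => ?_
    rw [← linForm_single, gAct_linForm, Matrix.one_mulVec]; rfl
  rw [this]; rfl

theorem det_of_mem_Uset {g : Matrix (Fin n) (Fin n) F} (hg : g ∈ Uset F n) : g.det = 1 := by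
  rw [Matrix.det_of_isUpperTriangular fun i j h => hg.1 i j h]
  exact Finset.prod_eq_one fun i _ => hg.2 i

/-- The substitution by an invertible matrix, as an automorphism. -/
def gActEquiv (g : Matrix (Fin n) (Fin n) F) (hg : IsUnit g.det) : SV F n ≃ₐ[F] SV F n :=
  AlgEquiv.ofAlgHom (gAct F n g) (gAct F n g⁻¹)
    (AlgHom.ext fun p => by
      rw [AlgHom.comp_apply, gAct_gAct, Matrix.mul_nonsing_inv _ hg, gAct_one]; rfl)
    (AlgHom.ext fun p => by
      rw [AlgHom.comp_apply, gAct_gAct, Matrix.nonsing_inv_mul _ hg, gAct_one]; rfl)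

/-- Vectors whose last nonzero coordinate is a `1` in position `a`. -/
def monicVecs (F : Type) [Field F] (n : ℕ) (a : Fin n) : Set (Fin n → F) :=
  {v | v a = 1 ∧ ∀ s, a < s → v s = 0}

theorem mulVec_mem_monicVecs {g : Matrix (Fin n) (Fin n) F} (hg : g ∈ Uset F n) {a : Fin n}
    {v : Fin n → F} (hv : v ∈ monicVecs F n a) : g.mulVec v ∈ monicVecs F n a := by
  constructor
  · rw [Matrix.mulVec, dotProduct, Finset.sum_eq_single a, hg.2, hv.1, one_mul]
    · intro b _ hb
      rcases lt_or_gt_of_ne hb with h | h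
      · rw [hg.1 _ _ h, zero_mul]
      · rw [hv.2 _ h, mul_zero]
    · simp
  · intro r hr
    rw [Matrix.mulVec, dotProduct]
    refine Finset.sum_eq_zero fun s _ => ?_
    rcases lt_or_ge s r with h | h
    · rw [hg.1 _ _ h, zero_mul]
    · rw [hv.2 _ (hr.trans_le h), mul_zero]

theorem exists_mem_Uset_mulVec {a : Fin n} {v : Fin n → F} (hv : v ∈ monicVecs F n a) :
    ∃ g ∈ Uset F n, g.mulVec (Pi.single a 1) = v := by
  refine ⟨Matrix.of fun i j => if j = a then v i else if i = j then 1 else 0,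
    ⟨fun i j hij => ?_, fun i => ?_⟩, ?_⟩
  · by_cases hj : j = a
    · subst hj; simp [hv.2 i hij]
    · simp [hj, hij.ne']
  · by_cases hi : i = a
    · subst hi; simp [hv.1]
    · simp [hi]
  · ext i; simp

theorem eval_linForm (z v : Fin n → F) : eval z (linForm v) = ∑ s, v s * z s := by
  simp [linForm_eq]

theorem not_linForm_dvd {a : Fin n} {v v' : Fin n → F} (hv : v ∈ monicVecs F n a)
    (hv' : v' ∈ monicVecs F n a) (hne : v ≠ v') : ¬ linForm v ∣ linForm v' := by
  rintro ⟨h, hh⟩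
  obtain ⟨k, hk⟩ := Function.ne_iff.1 hne
  have hka : k ≠ a := fun h => hk (by rw [h, hv.1, hv'.1])
  have := congrArg (eval (Pi.single k 1 - Pi.single a (v k) : Fin n → F)) hh
  rw [map_mul, linForm_eq, linForm_eq] at this
  simp [mul_sub, Pi.single_apply, Finset.sum_sub_distrib, hv.1, hv'.1] at this
  exact hk (sub_eq_zero.1 this).symm

theorem mem_invS_of_mul_mem {a h : SV F n} {P : Set (Matrix (Fin n) (Fin n) F)}
    (ha : a ∈ invS F n P) (h0 : a ≠ 0) (hah : a * h ∈ invS F n P) : h ∈ invS F n P := by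
  intro g hg
  have := hah g hg
  rw [map_mul, ha g hg] at this
  exact mul_left_cancel₀ h0 this

variable [Fintype F]

instance (a : Fin n) : Fintype (monicVecs F n a) := Fintype.ofFinite _

theorem linProd_eq (a : Fin n) :
    linProd F n a a = ∏ v : monicVecs F n a, linForm (v : Fin n → F) := by
  classical
  refine Finset.prod_bij' (fun c _ => ⟨fun s => if h : (s : ℕ) < a then c ⟨s, h⟩ else
    if s = a then 1 else 0, ?_⟩) (fun v _ k => v.1 ⟨k, k.2.trans a.2⟩) ?_ ?_ ?_ ?_ ?_
  · refine ⟨by simp, fun s hs => ?_⟩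
    have : ¬ ((s : ℕ) < a) := not_lt.2 hs.le
    simp [this, hs.ne']
  · intro c _; exact mem_univ _
  · intro v _; exact mem_univ _
  · intro c _; ext k; simp
  · rintro ⟨v, hv⟩ _
    ext s
    rcases lt_trichotomy s a with h | h | h
    · simp [h]
    · subst h; simp [hv.1]
    · simp [hv.2 s h, h.ne', not_lt.2 h.le]
  · intro c _
    rw [linForm_eq]
    have hX : ∀ k : ℕ, (hk : k < n) → xV F n k = X ⟨k, hk⟩ := fun k hk => by simp [xV, hk]
    have hsub := Finset.sum_subset
      (Finset.subset_univ (insert a (univ.map (Fin.castLEEmb a.2.le))))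
      (f := fun s : Fin n => (C (if h : (s : ℕ) < a then c ⟨s, h⟩ else if s = a then 1 else 0) *
        X s : SV F n)) (by
        intro s _ hs
        rw [Finset.mem_insert, not_or] at hs
        have hlt : ¬ ((s : ℕ) < a) := fun h => hs.2 (Finset.mem_map.2 ⟨⟨s, h⟩, mem_univ _, rfl⟩)
        simp [hlt, hs.1])
    rw [← hsub, Finset.sum_insert, Finset.sum_map, add_comm, hX a a.2]
    · congr 1
      · simp
      · refine Finset.sum_congr rfl fun k _ => ?_
        rw [hX k (k.2.trans a.2)]
        have hk : ((Fin.castLEEmb a.2.le k : Fin n) : ℕ) < a := k.2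
        rw [dif_pos hk]
        rfl
    · intro h
      obtain ⟨k, _, hk⟩ := Finset.mem_map.1 h
      have := congrArg Fin.val hk
      have h2 := k.2
      simp at this
      omega

theorem linProd_mem_invS (a : Fin n) : linProd F n a a ∈ invS F n (Uset F n) := by
  classical
  intro g hg
  rw [linProd_eq, map_prod]
  have hinj : Function.Injective fun v : monicVecs F n a =>
      (⟨g.mulVec v, mulVec_mem_monicVecs hg v.2⟩ : monicVecs F n a) := by
    intro v v' h
    refine Subtype.ext (Matrix.mulVec_injective_of_isUnit ?_ (congrArg Subtype.val h))
    rw [Matrix.isUnit_iff_isUnit_det, det_of_mem_Uset hg]; exact isUnit_one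
  refine Fintype.prod_bijective _ (Finite.injective_iff_bijective.1 hinj) _ _ fun v => ?_
  exact gAct_linForm g v

theorem linProd_dvd {a : Fin n} {p : SV F n} (hp : p ∈ invS F n (Uset F n))
    (hX : X a ∣ p) : linProd F n a a ∣ p := by
  rw [linProd_eq]
  refine Fintype.prod_dvd_of_isRelPrime (fun v v' hne => ?_) fun v => ?_
  · obtain ⟨g, hg, hgv⟩ := exists_mem_Uset_mulVec v.2
    have hpr : Prime (linForm (v : Fin n → F)) := by
      have hu : IsUnit g.det := by rw [det_of_mem_Uset hg]; exact isUnit_one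
      have : gActEquiv g hu (X a) = linForm (v : Fin n → F) := by
        rw [← hgv, ← gAct_linForm, linForm_single]; rfl
      rw [← this, MulEquiv.prime_iff]
      exact MvPolynomial.X_prime
    exact hpr.irreducible.isRelPrime_iff_not_dvd.2
      (not_linForm_dvd v.2 v'.2 fun h => hne (Subtype.ext h))
  · obtain ⟨g, hg, hgv⟩ := exists_mem_Uset_mulVec v.2
    have := map_dvd (gAct F n g) hX
    rwa [hp g hg, ← linForm_single, gAct_linForm, hgv] at this

theorem linProd_ne_zero (a : Fin n) : linProd F n a a ≠ 0 := by
  intro h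
  have := congrArg (eval (Pi.single a 1 : Fin n → F)) h
  rw [linProd_eq, map_prod, map_zero] at this
  refine one_ne_zero (α := F) (Eq.trans (Eq.symm (Finset.prod_eq_one fun v _ => ?_)) this)
  simp [eval_linForm, Pi.single_apply, v.2.1]

theorem not_X_dvd_linProd {a t : Fin n} (h : t ≠ a) : ¬ X t ∣ linProd F n a a := by
  rintro ⟨p, hp⟩
  have := congrArg (eval (Pi.single a 1 : Fin n → F)) hp
  rw [linProd_eq, map_prod, map_mul, eval_X, Pi.single_eq_of_ne h, zero_mul] at this
  refine one_ne_zero (α := F) (Eq.trans (Eq.symm (Finset.prod_eq_one fun v _ => ?_)) this)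
  simp [eval_linForm, Pi.single_apply, v.2.1]

theorem Lm_ne_zero {m : ℕ} (hm : m ≤ n) : Lm F n m ≠ 0 :=
  Finset.prod_ne_zero_iff.2 fun a ha =>
    linProd_ne_zero (⟨a, (Finset.mem_range.1 ha).trans_le hm⟩ : Fin n)

theorem Lm_mem_invS {m : ℕ} (hm : m ≤ n) : Lm F n m ∈ invS F n (Uset F n) :=
  Subalgebra.prod_mem _ fun a ha =>
    linProd_mem_invS (⟨a, (Finset.mem_range.1 ha).trans_le hm⟩ : Fin n)

theorem Lm_dvd {m : ℕ} (hm : m ≤ n) {p : SV F n} (hp : p ∈ invS F n (Uset F n))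
    (hX : ∀ t : Fin n, (t : ℕ) < m → X t ∣ p) : Lm F n m ∣ p := by
  induction m with
  | zero => simp [Lm]
  | succ m ih =>
    obtain ⟨h, rfl⟩ := ih (by omega) fun t ht => hX t (by omega)
    have hh := mem_invS_of_mul_mem (Lm_mem_invS (by omega)) (Lm_ne_zero (by omega)) hp
    have hL : Lm F n (m + 1) = Lm F n m * linProd F n m m := by
      rw [Lm, Finset.prod_range_succ]; rfl
    rw [hL]
    refine mul_dvd_mul_left _ (linProd_dvd (a := ⟨m, by omega⟩) hh ?_)
    refine (MvPolynomial.X_prime.dvd_or_dvd (hX ⟨m, by omega⟩ (by simp))).resolve_left ?_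
    intro hdvd
    obtain ⟨a, ha, hdvd⟩ := (MvPolynomial.X_prime.dvd_finsetProd_iff _).1 hdvd
    have ham := Finset.mem_range.1 ha
    exact not_X_dvd_linProd (a := ⟨a, by omega⟩) (t := ⟨m, by omega⟩)
      (by simp; omega) hdvd

end Unitriangular

section Killing

variable {F : Type} [Field F] {n : ℕ}

/-- The substitution `x_t ↦ 0`. -/
def killVar (F : Type) [Field F] {n : ℕ} (t : Fin n) : SV F n →ₐ[F] SV F n :=
  aeval fun s => if s = t then 0 else X s

/-- The substitution `x_s ↦ 0` for all `s ≥ k`. -/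
def truncVars (F : Type) [Field F] (n k : ℕ) : SV F n →ₐ[F] SV F n :=
  aeval fun s : Fin n => if (s : ℕ) < k then X s else 0

theorem X_dvd_sub_killVar (t : Fin n) (p : SV F n) : X t ∣ p - killVar F t p := by
  induction p using MvPolynomial.induction_on with
  | C a => simp [killVar]
  | add p q hp hq =>
    rw [map_add, add_sub_add_comm]; exact dvd_add hp hq
  | mul_X p s hp =>
    by_cases h : s = t
    · subst h; simp [killVar]
    · have : p * X s - killVar F t (p * X s) = (p - killVar F t p) * X s := by
        simp [killVar, h, sub_mul]
      rw [this]; exact Dvd.dvd.mul_right hp _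

theorem X_dvd_of_killVar_eq_zero {t : Fin n} {p : SV F n} (h : killVar F t p = 0) : X t ∣ p := by
  simpa [h] using X_dvd_sub_killVar t p

theorem totalDegree_aeval_le (u : Fin n → SV F n) (hu : ∀ s, (u s).totalDegree ≤ 1)
    (p : SV F n) : (aeval u p : SV F n).totalDegree ≤ p.totalDegree := by
  rw [aeval_def, eval₂_eq]
  refine totalDegree_finsetSum_le fun d hd => ?_
  refine (totalDegree_mul _ _).trans ?_
  rw [algebraMap_eq, totalDegree_C, zero_add]
  refine (totalDegree_finsetProd _ _).trans ?_
  refine le_trans (Finset.sum_le_sum fun i _ => (totalDegree_pow _ _).trans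
    (Nat.mul_le_mul_left _ (hu i))) ?_
  simpa [Finsupp.sum] using le_totalDegree hd

theorem truncVars_succ {k : ℕ} (hk : k < n) (p : SV F n) :
    killVar F (⟨k, hk⟩ : Fin n) (truncVars F n (k + 1) p) = truncVars F n k p := by
  have : (killVar F (⟨k, hk⟩ : Fin n)).comp (truncVars F n (k + 1)) = truncVars F n k := by
    refine MvPolynomial.algHom_ext fun s => ?_
    rcases lt_trichotomy (s : ℕ) k with h | h | h
    · simp [killVar, truncVars, h, h.le, Fin.ext_iff, h.ne]
    · simp [killVar, truncVars, h, Fin.ext_iff]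
    · simp [killVar, truncVars, h.not_ge, h.le.not_gt]
  rw [← this]; rfl

theorem truncVars_self (p : SV F n) : truncVars F n n p = p := by
  have : truncVars F n n = AlgHom.id F (SV F n) :=
    MvPolynomial.algHom_ext fun s => by simp [truncVars]
  rw [this]; rfl

theorem truncVars_zero (p : SV F n) : truncVars F n 0 p = C (constantCoeff p) := by
  have : (fun s : Fin n => if (s : ℕ) < 0 then (X s : SV F n) else 0) = fun _ => 0 := by simp
  rw [truncVars, this, aeval_zero', MvPolynomial.algebraMap_eq]

theorem truncVars_mem_invS (k : ℕ) {p : SV F n} (hp : p ∈ invS F n (Uset F n)) :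
    truncVars F n k p ∈ invS F n (Uset F n) := by
  intro g hg
  let g' : Matrix (Fin n) (Fin n) F := Matrix.of fun i j =>
    if (j : ℕ) < k then g i j else if i = j then 1 else 0
  have hg' : g' ∈ Uset F n := by
    refine ⟨fun i j hij => ?_, fun i => ?_⟩
    · by_cases h : (j : ℕ) < k
      · simp [g', h, hg.1 i j hij]
      · simp [g', h, hij.ne']
    · by_cases h : (i : ℕ) < k
      · simp [g', h, hg.2 i]
      · simp [g', h]
  have h : (gAct F n g).comp (truncVars F n k) = (truncVars F n k).comp (gAct F n g') := by
    refine MvPolynomial.algHom_ext fun j => ?_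
    by_cases hj : (j : ℕ) < k
    · simp only [AlgHom.comp_apply, gAct_X, map_sum, map_mul, truncVars, aeval_X, aeval_C, hj,
        if_true, g', Matrix.of_apply, MvPolynomial.algebraMap_eq]
      refine Finset.sum_congr rfl fun i _ => ?_
      by_cases hi : (i : ℕ) < k
      · rw [if_pos hi]
      · rw [if_neg hi, hg.1 i j (Fin.lt_def.2 (lt_of_lt_of_le hj (not_lt.1 hi))), map_zero,
          zero_mul, zero_mul]
    · simp only [AlgHom.comp_apply, gAct_X, map_sum, map_mul, truncVars, aeval_X, aeval_C, hj,
        if_false, g', Matrix.of_apply, MvPolynomial.algebraMap_eq, map_zero]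
      refine (Finset.sum_eq_zero fun i _ => ?_).symm
      by_cases hi : i = j
      · subst hi; simp [hj]
      · simp [hi]
  have := congrArg (fun φ => φ p) h
  simp only [AlgHom.comp_apply] at this
  rw [this, hp g' hg']

variable [Fintype F]

theorem totalDegree_linProd_ne_zero (a : Fin n) : (linProd F n a a).totalDegree ≠ 0 := by
  intro h
  rw [totalDegree_eq_zero_iff_eq_C] at h
  have hX : X a ∣ linProd F n a a := by
    rw [linProd_eq]
    refine Dvd.dvd.trans ?_ (Finset.dvd_prod_of_mem _
      (mem_univ (⟨Pi.single a 1, by simp, fun s hs => by simp [hs.ne']⟩ : monicVecs F n a)))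
    rw [linForm_single]
  obtain ⟨p, hp⟩ := hX
  have h0 := congrArg (eval (0 : Fin n → F)) hp
  rw [h, eval_C, map_mul, eval_X, Pi.zero_apply, zero_mul] at h0
  rw [h0, map_zero] at h
  exact linProd_ne_zero a h

theorem truncVars_linProd {k : ℕ} (a : Fin n) (h : (a : ℕ) < k) :
    truncVars F n k (linProd F n a a) = linProd F n a a := by
  rw [linProd, map_prod]
  refine Finset.prod_congr rfl fun c _ => ?_
  have hX : ∀ j : ℕ, j < k → truncVars F n k (xV F n j) = xV F n j := fun j hj => by
    unfold xV
    split_ifs with hn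
    · simp [truncVars, hj]
    · simp
  rw [map_add, map_sum, hX a h]
  congr 1
  refine Finset.sum_congr rfl fun j _ => ?_
  rw [map_mul, hX j (j.2.trans h)]
  simp [truncVars]

theorem invS_Uset_eq_adjoin :
    invS F n (Uset F n) = Algebra.adjoin F (Set.range fun a : Fin n => linProd F n a a) := by
  refine le_antisymm ?_ (Algebra.adjoin_le ?_)
  · suffices H : ∀ k ≤ n, ∀ p ∈ invS F n (Uset F n), truncVars F n k p = p →
        p ∈ Algebra.adjoin F (Set.range fun a : Fin n => linProd F n a a) from
      fun p hp => H n le_rfl p hp (truncVars_self p)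
    intro k
    induction k with
    | zero =>
      intro _ p _ h
      rw [← h, truncVars_zero]
      exact Subalgebra.algebraMap_mem _ _
    | succ k ih =>
      intro hk p hp htr
      induction hd : p.totalDegree using Nat.strong_induction_on generalizing p with
      | _ d ihd =>
        let a : Fin n := ⟨k, hk⟩
        have hkill : killVar F a p = truncVars F n k p := by
          rw [← truncVars_succ hk, htr]
        have hq := truncVars_mem_invS k hp
        have hqq : truncVars F n k (truncVars F n k p) = truncVars F n k p := by
          have : (truncVars F n k).comp (truncVars F n k) = truncVars F n k :=
            MvPolynomial.algHom_ext fun s => by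
              by_cases h : (s : ℕ) < k <;> simp [truncVars, h]
          exact congrArg (fun φ => φ p) this
        have hdvd : X a ∣ p - truncVars F n k p := hkill ▸ X_dvd_sub_killVar a p
        obtain ⟨h, hh⟩ := linProd_dvd (Subalgebra.sub_mem _ hp hq) hdvd
        have hhinv : h ∈ invS F n (Uset F n) :=
          mem_invS_of_mul_mem (linProd_mem_invS a) (linProd_ne_zero a)
            (hh ▸ Subalgebra.sub_mem _ hp hq)
        have hqq' : truncVars F n (k + 1) (truncVars F n k p) = truncVars F n k p := by
          have : (truncVars F n (k + 1)).comp (truncVars F n k) = truncVars F n k :=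
            MvPolynomial.algHom_ext fun s => by
              by_cases h : (s : ℕ) < k
              · simp [truncVars, h, h.le]
              · simp [truncVars, h]
          exact congrArg (fun φ => φ p) this
        have hhtr : truncVars F n (k + 1) h = h := by
          refine mul_left_cancel₀ (linProd_ne_zero (F := F) a) ?_
          rw [← hh]
          nth_rw 1 [← truncVars_linProd (k := k + 1) a (Nat.lt_succ_self k)]
          rw [← map_mul, ← hh, map_sub, htr, hqq']
        have hmem : h ∈ Algebra.adjoin F (Set.range fun a : Fin n => linProd F n a a) := by
          by_cases h0 : h = 0
          · rw [h0]; exact Subalgebra.zero_mem _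
          refine ihd _ ?_ h hhinv hhtr rfl
          have h1 : (p - truncVars F n k p).totalDegree ≤ d := by
            refine (totalDegree_sub _ _).trans (max_le hd.le ?_)
            rw [← hd]
            refine totalDegree_aeval_le _ (fun s => ?_) p
            split_ifs
            · simp
            · simp
          rw [hh, totalDegree_mul_of_isDomain (linProd_ne_zero a) h0] at h1
          have := totalDegree_linProd_ne_zero (F := F) a
          omega
        rw [← sub_add_cancel p (truncVars F n k p), hh]
        exact Subalgebra.add_mem _ (Subalgebra.mul_mem _
          (Algebra.subset_adjoin ⟨a, rfl⟩) hmem) (ih (by omega) _ hq hqq)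
  · rintro _ ⟨a, rfl⟩
    exact linProd_mem_invS a

end Killing

section Moore

variable {F : Type} [Field F] {n : ℕ}

/-- The coordinates `x_s ^ (q ^ i)` of the `i`-th Frobenius twist of the tautological form. -/
def frobCoord (F : Type) [Field F] (q n i : ℕ) : Fin n → SV F n := fun s => X s ^ q ^ i

theorem subDet_eq_det (q : ℕ) {k : ℕ} {R T : Finset ℕ} (r c : Fin k → ℕ)
    (hr : StrictMono r) (hc : StrictMono c) (hR : univ.image r = R) (hT : univ.image c = T) :
    subDet F q n R T = (Matrix.of fun i j : Fin k => xV F n (c j) ^ q ^ r i).det := by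
  have hRk : R.card = k := by
    rw [← hR, Finset.card_image_of_injective _ hr.injective, Finset.card_univ, Fintype.card_fin]
  have hTk : T.card = k := by
    rw [← hT, Finset.card_image_of_injective _ hc.injective, Finset.card_univ, Fintype.card_fin]
  subst hRk
  rw [subDet, dif_pos hTk]
  have h1 : r = R.orderEmbOfFin rfl := Finset.orderEmbOfFin_unique _
    (fun i => (Finset.ext_iff.1 hR _).1 (Finset.mem_image_of_mem _ (mem_univ i))) hr
  have h2 : c = T.orderEmbOfFin hTk := Finset.orderEmbOfFin_unique _
    (fun i => (Finset.ext_iff.1 hT _).1 (Finset.mem_image_of_mem _ (mem_univ i))) hc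
  rw [← h1, ← h2]

theorem image_val_univ (m : ℕ) : univ.image (fun i : Fin m => (i : ℕ)) = range m := by
  ext a
  simp only [mem_image, mem_univ, true_and, mem_range]
  exact ⟨fun ⟨i, hi⟩ => hi ▸ i.2, fun h => ⟨⟨a, h⟩, rfl⟩⟩

theorem subDet_range_eq_det (q : ℕ) {m : ℕ} (hm : m ≤ n) :
    subDet F q n (range m) (range m) =
      (Matrix.of fun i j : Fin m => frobCoord F q n i (Fin.castLE hm j)).det := by
  rw [subDet_eq_det q (fun i : Fin m => (i : ℕ)) (fun i : Fin m => (i : ℕ))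
    (fun _ _ h => h) (fun _ _ h => h) (image_val_univ m) (image_val_univ m)]
  congr 1
  ext1 i j
  have : xV F n j = X (Fin.castLE hm j) := by
    rw [xV, dif_pos (j.2.trans_le hm)]; rfl
  rw [Matrix.of_apply, Matrix.of_apply, this, frobCoord]

theorem totalDegree_subDet_range_le (q : ℕ) {m : ℕ} (hm : m ≤ n) :
    (subDet F q n (range m) (range m)).totalDegree ≤ ∑ c ∈ range m, q ^ c := by
  rw [subDet_range_eq_det q hm, Matrix.det_apply']
  refine totalDegree_finsetSum_le fun τ _ => (totalDegree_mul _ _).trans ?_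
  have h0 : (((Equiv.Perm.sign τ : ℤˣ) : ℤ) : SV F n).totalDegree = 0 := by
    rw [← map_intCast (C : F →+* SV F n), totalDegree_C]
  rw [h0, zero_add]
  refine (totalDegree_finsetProd _ _).trans ?_
  rw [Finset.sum_range fun c => q ^ c, ← Equiv.sum_comp τ fun i : Fin m => q ^ (i : ℕ)]
  refine Finset.sum_le_sum fun i _ => ?_
  rw [Matrix.of_apply, frobCoord, totalDegree_X_pow]

theorem X_dvd_subDet_range {q : ℕ} (hq : q ≠ 0) {m : ℕ} (hm : m ≤ n) (t : Fin n)
    (ht : (t : ℕ) < m) : X t ∣ subDet F q n (range m) (range m) := by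
  refine X_dvd_of_killVar_eq_zero ?_
  rw [subDet_range_eq_det q hm, AlgHom.map_det]
  refine Matrix.det_eq_zero_of_column_eq_zero ⟨t, ht⟩ fun i => ?_
  have : (Fin.castLE hm ⟨t, ht⟩ : Fin n) = t := rfl
  simp [this, frobCoord, killVar, hq]

theorem linForm_injective : Function.Injective (linForm : (Fin n → F) → SV F n) := by
  intro v v' h
  ext s
  simpa [eval_linForm, Pi.single_apply] using congrArg (eval (Pi.single s 1 : Fin n → F)) h

variable [Fintype F] {q : ℕ}

theorem pairing_frobCoord (hF : Fintype.card F = q) (i : ℕ) (v : Fin n → F) :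
    pairing (frobCoord F q n i) v = linForm v ^ q ^ i := by
  have h : ∀ x : SV F n, ((FiniteField.frobeniusAlgHom F (SV F n)) ^ i) x = x ^ q ^ i := by
    intro x
    rw [AlgHom.coe_pow, FiniteField.coe_frobeniusAlgHom, pow_iterate, hF]
  rw [← h, linForm, pairing, pairing, map_sum]
  exact Finset.sum_congr rfl fun s _ => by rw [map_smul, h, frobCoord]

theorem map_pairing_frobCoord (hF : Fintype.card F = q) (σ : SV F n →ₐ[F] SV F n)
    (A : (Fin n → F) →ₗ[F] (Fin n → F)) (h : ∀ v, σ (linForm v) = linForm (A v)) (i : ℕ)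
    (v : Fin n → F) :
    σ (pairing (frobCoord F q n i) v) = pairing (frobCoord F q n i) (A v) := by
  rw [pairing_frobCoord hF, pairing_frobCoord hF, map_pow, h]

theorem det_frobCoord_ne_zero (hF : Fintype.card F = q) {m : ℕ} (hm : m ≤ n) :
    (Matrix.of fun i j : Fin m => frobCoord F q n i (Fin.castLE hm j)).det ≠ 0 := by
  classical
  have hq : 1 < q := hF ▸ Fintype.one_lt_card
  intro h0
  obtain ⟨v, hv, hvM⟩ := Matrix.exists_vecMul_eq_zero_iff.2 h0
  let P : Polynomial (SV F n) := ∑ i : Fin m, Polynomial.monomial (q ^ (i : ℕ)) (v i)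
  let emb : (Fin m → F) → (Fin n → F) := fun c s => if h : (s : ℕ) < m then c ⟨s, h⟩ else 0
  have hemb : Function.Injective emb := by
    intro c c' h
    ext j
    simpa [emb] using congrFun h (Fin.castLE hm j)
  have hpair : ∀ (c : Fin m → F) (i : ℕ), pairing (frobCoord F q n i) (emb c) =
      ∑ j : Fin m, c j • frobCoord F q n i (Fin.castLE hm j) := by
    intro c i
    rw [pairing, ← Finset.sum_subset (Finset.subset_univ (univ.map (Fin.castLEEmb hm))),
      Finset.sum_map]
    · refine Finset.sum_congr rfl fun j _ => ?_
      have : emb c (Fin.castLEEmb hm j) = c j := dif_pos j.2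
      rw [this]; rfl
    · intro s _ hs
      have : ¬ (s : ℕ) < m := fun h => hs (Finset.mem_map.2 ⟨⟨s, h⟩, mem_univ _, rfl⟩)
      simp [emb, this]
  have heval : ∀ c, P.eval (linForm (emb c)) = 0 := by
    intro c
    have : P.eval (linForm (emb c)) =
        ∑ j : Fin m, c j • ∑ i : Fin m, v i * frobCoord F q n i (Fin.castLE hm j) := by
      simp only [P, Polynomial.eval_finsetSum, Polynomial.eval_monomial, ← pairing_frobCoord hF,
        hpair, Finset.mul_sum, Finset.smul_sum, mul_smul_comm]
      rw [Finset.sum_comm]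
    rw [this]
    refine Finset.sum_eq_zero fun j _ => ?_
    have hj := congrFun hvM j
    rw [Matrix.vecMul, dotProduct, Pi.zero_apply] at hj
    simp only [Matrix.of_apply] at hj
    rw [hj, smul_zero]
  have hP : P = 0 := by
    refine Polynomial.eq_zero_of_natDegree_lt_card_of_eval_eq_zero P
      (f := fun c => linForm (emb c)) (linForm_injective.comp hemb) heval ?_
    rw [Fintype.card_fun, Fintype.card_fin, hF]
    refine lt_of_le_of_lt (Polynomial.natDegree_sum_le_of_forall_le (n := q ^ (m - 1)) _ _
      fun i _ => (Polynomial.natDegree_monomial_le _).trans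
        (Nat.pow_le_pow_right (by omega) (by have := i.2; omega))) ?_
    have hm0 : m ≠ 0 := by
      rintro rfl
      exact hv (funext fun i => i.elim0)
    exact Nat.pow_lt_pow_right hq (by omega)
  refine hv (funext fun i => ?_)
  have := congrArg (fun p => Polynomial.coeff p (q ^ (i : ℕ))) hP
  simp only [P, Polynomial.finsetSum_coeff, Polynomial.coeff_monomial, Polynomial.coeff_zero] at this
  rw [Finset.sum_eq_single i] at this
  · simpa using this
  · intro j _ hj
    rw [if_neg]
    intro h
    exact hj (Fin.ext (Nat.pow_right_injective hq h))
  · simp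

theorem subDet_range_ne_zero (hF : Fintype.card F = q) {m : ℕ} (hm : m ≤ n) :
    subDet F q n (range m) (range m) ≠ 0 := by
  rw [subDet_range_eq_det q hm]
  exact det_frobCoord_ne_zero hF hm

theorem totalDegree_Lm (hF : Fintype.card F = q) {m : ℕ} (hm : m ≤ n) :
    (Lm F n m).totalDegree = ∑ c ∈ range m, q ^ c := by
  refine IsHomogeneous.totalDegree ?_ (Lm_ne_zero hm)
  refine IsHomogeneous.prod _ _ _ fun a ha => ?_
  have hX : ∀ k, (xV F n k).IsHomogeneous 1 := by
    intro k
    unfold xV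
    split_ifs
    · exact isHomogeneous_X _ _
    · exact isHomogeneous_zero _ _ _
  have : q ^ a = ∑ _c : Fin a → F, 1 := by simp [hF]
  rw [this]
  refine IsHomogeneous.prod _ _ _ fun c _ => IsHomogeneous.add
    (IsHomogeneous.sum _ _ _ fun k _ => ?_) (hX a)
  simpa using (isHomogeneous_C (Fin n) (c k)).mul (hX k)

/-- The Moore determinant divides every `U_n`-invariant divisible by its variables. -/
theorem subDet_range_dvd (hF : Fintype.card F = q) {m : ℕ} (hm : m ≤ n)
    (hD : subDet F q n (range m) (range m) ∈ invS F n (Uset F n))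
    {p : SV F n} (hp : p ∈ invS F n (Uset F n)) (hX : ∀ t : Fin n, (t : ℕ) < m → X t ∣ p) :
    subDet F q n (range m) (range m) ∣ p := by
  have hq : q ≠ 0 := hF ▸ Fintype.card_ne_zero
  obtain ⟨h, hh⟩ := Lm_dvd hm hD fun t ht => X_dvd_subDet_range hq hm t ht
  have hD0 := subDet_range_ne_zero (n := n) hF hm
  have h0 : h ≠ 0 := by
    rintro rfl
    exact hD0 (by rw [hh, mul_zero])
  have hdeg := totalDegree_subDet_range_le (F := F) q hm
  rw [hh, totalDegree_mul_of_isDomain (Lm_ne_zero hm) h0, totalDegree_Lm hF hm] at hdeg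
  have hC := (totalDegree_eq_zero_iff_eq_C).1 (by omega : h.totalDegree = 0)
  have hu : IsUnit h := by
    rw [hC]
    refine IsUnit.map C (isUnit_iff_ne_zero.2 fun h' => h0 ?_)
    rw [hC, h', map_zero]
  rw [hh]
  exact (hu.mul_right_dvd).2 (Lm_dvd hm hp hX)

end Moore

section Expansion

variable {F : Type} [Field F] {n : ℕ}

/-- The monomial `y_S` as an element of `S(V) ⊗ Λ(V)`. -/
def extMon (F : Type) [Field F] (n : ℕ) (S : Finset ℕ) : SL F n := 1 ⊗ₜ yProd F n S

/-- The basis vector `e_a` of `F^n`, with value `0` out of range. -/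
def stdVec (F : Type) [Field F] (n a : ℕ) : Fin n → F :=
  if h : a < n then Pi.single ⟨a, h⟩ 1 else 0

theorem yV_eq (a : ℕ) : yV F n a = ExteriorAlgebra.ι F (stdVec F n a) := by
  unfold yV stdVec
  split_ifs <;> simp

theorem extMon_empty : extMon F n ∅ = 1 := by
  simp [extMon, yProd]; rfl

theorem extMon_insert {a : ℕ} {S : Finset ℕ} (h : ∀ s ∈ S, a < s) :
    extMon F n (insert a S) = extVec (stdVec F n a) * extMon F n S := by
  have hs : (insert a S).sort (· ≤ ·) = a :: S.sort (· ≤ ·) :=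
    Finset.sort_insert _ (fun s hs => (h s hs).le) fun ha => lt_irrefl _ (h a ha)
  rw [extMon, yProd, hs, List.map_cons, List.prod_cons, yV_eq, extVec, extMon,
    Algebra.TensorProduct.tmul_mul_tmul, one_mul, yProd]

theorem pairing_frobCoord_stdVec {q : ℕ} (hq : q ≠ 0) (c a : ℕ) :
    pairing (frobCoord F q n c) (stdVec F n a) = xV F n a ^ q ^ c := by
  unfold stdVec xV
  split_ifs with h
  · rw [pairing_single, frobCoord]
  · simp [pairing, hq]

theorem contr_extMon (w : Fin n → SV F n) (S : Finset ℕ) :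
    contr w (extMon F n S) = ∑ t ∈ S, ((-1) ^ (S.filter (· < t)).card *
      pairing w (stdVec F n t)) • extMon F n (S.erase t) := by
  induction S using Finset.induction_on_min with
  | empty => rw [extMon_empty, sum_empty]; exact contr_scalar w 1
  | insert a S ha ih =>
    have haS : a ∉ S := fun h => lt_irrefl _ (ha a h)
    rw [extMon_insert ha, contr_extVec_mul, ih, sum_insert haS, Finset.erase_insert haS,
      sub_eq_add_neg, mul_sum, ← sum_neg_distrib]
    congr 1
    · have : (insert a S).filter (· < a) = ∅ := by
        refine Finset.filter_eq_empty_iff.2 fun s hs => ?_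
        rcases mem_insert.1 hs with rfl | hs
        · exact lt_irrefl _
        · exact (ha s hs).not_gt
      rw [this, card_empty, pow_zero, one_mul]
    · refine sum_congr rfl fun t ht => ?_
      have hat := ha t ht
      rw [Finset.filter_insert, if_pos hat, card_insert_of_notMem (by simp [haS]),
        Finset.erase_insert_of_ne hat.ne, extMon_insert fun s hs => ha s (mem_of_mem_erase hs),
        pow_succ, mul_neg_one, neg_mul, mul_smul_comm]
      exact (neg_smul _ _).symm

theorem scalarPart_extMon {S : Finset ℕ} (h : S.Nonempty) : scalarPart F n (extMon F n S) = 0 := by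
  obtain ⟨a, S', rfl, h'⟩ : ∃ a S', S = insert a S' ∧ ∀ s ∈ S', a < s :=
    ⟨S.min' h, S.erase (S.min' h), (Finset.insert_erase (S.min'_mem h)).symm,
      fun s hs => S.min'_lt_of_mem_erase_min' h hs⟩
  rw [extMon_insert h', scalarPart_extVec_mul]

theorem subDet_eq_zero {q : ℕ} {R T : Finset ℕ} (h : T.card ≠ R.card) : subDet F q n R T = 0 :=
  dif_neg h

theorem subDet_insert (q : ℕ) {c : ℕ} {C T : Finset ℕ} (hc : ∀ i ∈ C, c < i) :
    subDet F q n (insert c C) T = ∑ t ∈ T, (-1) ^ (T.filter (· < t)).card *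
      xV F n t ^ q ^ c * subDet F q n C (T.erase t) := by
  have hcC : c ∉ C := fun h => lt_irrefl _ (hc c h)
  by_cases hT : T.card = C.card + 1
  · let e := T.orderEmbOfFin hT
    let r := C.orderEmbOfFin rfl
    have heT : univ.image e = T := Finset.image_orderEmbOfFin_univ T hT
    have hrC : univ.image r = C := Finset.image_orderEmbOfFin_univ C rfl
    let r' : Fin (C.card + 1) → ℕ := Fin.cons c r
    have hcons : StrictMono r' := by
      intro i j hij
      induction j using Fin.cases with
      | zero => exact absurd hij (Fin.not_lt_zero _)
      | succ j =>
        induction i using Fin.cases with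
        | zero => exact hc _ (Finset.orderEmbOfFin_mem C rfl j)
        | succ i => exact r.strictMono (Fin.succ_lt_succ_iff.1 hij)
    have himage : univ.image r' = insert c C := by
      rw [Fin.univ_succ, Finset.cons_eq_insert, Finset.image_insert, Finset.map_eq_image,
        Finset.image_image]
      exact congrArg (insert c) hrC
    have hsum : ∀ f : ℕ → SV F n, ∑ t ∈ T, f t = ∑ j, f (e j) := fun f => by
      rw [← sum_image (s := univ) (g := e) fun i _ j _ h => e.injective h, heT]
    rw [subDet_eq_det q r' e hcons e.strictMono himage heT, Matrix.det_succ_row_zero, hsum]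
    refine sum_congr rfl fun j _ => ?_
    have hcard : (T.filter (· < e j)).card = j := by
      rw [← heT, Finset.filter_image, card_image_of_injective _ e.injective]
      have : univ.filter (fun i => e i < e j) = Iio j := by
        ext i
        simp
      rw [this, Fin.card_Iio]
    have herase : univ.image (e ∘ j.succAbove) = T.erase (e j) := by
      rw [← Finset.image_image, Fin.image_succAbove_univ, compl_singleton,
        Finset.image_erase e.injective, heT]
    rw [hcard, subDet_eq_det q r (e ∘ j.succAbove) r.strictMono
      (e.strictMono.comp (Fin.strictMono_succAbove j)) hrC herase]
    rfl
  · rw [subDet_eq_zero (by rwa [card_insert_of_notMem hcC])]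
    refine (sum_eq_zero fun t ht => ?_).symm
    rw [subDet_eq_zero, mul_zero]
    have := card_erase_add_one ht
    omega

/-- The signed expansion `∑_S ± det(x_t^{q^c})_{c ∈ C, t ∉ S} y_S` over subsets `S` of
`{0,…,m-1}`. -/
def detExpansion (F : Type) [Field F] (q n m : ℕ) (C : Finset ℕ) : SL F n :=
  ∑ S ∈ (range m).powerset,
    ((-1) ^ (∑ s ∈ S, s) * subDet F q n C (range m \ S)) • extMon F n S

theorem contr_detExpansion {q : ℕ} (hq : q ≠ 0) (m : ℕ) {c : ℕ} {C : Finset ℕ}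
    (hc : ∀ i ∈ C, c < i) :
    contr (frobCoord F q n c) (detExpansion F q n m C) = detExpansion F q n m (insert c C) := by
  simp only [detExpansion, map_sum, map_smul, contr_extMon, subDet_insert q hc, smul_sum, mul_sum,
    sum_smul, smul_smul, pairing_frobCoord_stdVec hq]
  rw [sum_sigma', sum_sigma']
  refine Finset.sum_bij' (fun x _ => ⟨x.1.erase x.2, x.2⟩) (fun x _ => ⟨insert x.2 x.1, x.2⟩)
    ?_ ?_ ?_ ?_ ?_
  · rintro ⟨S, t⟩ h
    simp only [mem_sigma, mem_powerset, mem_sdiff] at h ⊢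
    exact ⟨(erase_subset _ _).trans h.1, h.1 h.2, notMem_erase _ _⟩
  · rintro ⟨S, t⟩ h
    simp only [mem_sigma, mem_powerset, mem_sdiff] at h ⊢
    exact ⟨insert_subset h.2.1 h.1, mem_insert_self _ _⟩
  · rintro ⟨S, t⟩ h
    simp only [mem_sigma] at h
    simp [insert_erase h.2]
  · rintro ⟨S, t⟩ h
    simp only [mem_sigma, mem_sdiff] at h
    simp [erase_insert h.2.2]
  · rintro ⟨S, t⟩ h
    simp only [mem_sigma, mem_powerset] at h
    obtain ⟨hS, ht⟩ := h
    simp only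
    congr 1
    have hsd : (range m \ S.erase t).erase t = range m \ S := by
      ext i
      simp only [mem_erase, mem_sdiff]
      have := hS ht
      grind
    have hcard : ((range m \ S.erase t).filter (· < t)).card + (S.filter (· < t)).card = t := by
      rw [← card_union_of_disjoint]
      · refine Eq.trans (congrArg card ?_) (card_range t)
        ext i
        have := mem_range.1 (hS ht)
        simp only [mem_union, mem_filter, mem_sdiff, mem_erase, mem_range]
        grind
      · rw [Finset.disjoint_left]
        simp only [mem_filter, mem_sdiff, mem_erase]
        grind
    have hsum := sum_erase_add S (fun i => i) ht
    have hsign : (-1 : SV F n) ^ (∑ s ∈ S, s) * (-1) ^ (S.filter (· < t)).card =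
        (-1) ^ (∑ s ∈ S.erase t, s) * (-1) ^ ((range m \ S.erase t).filter (· < t)).card := by
      rw [← pow_add, ← pow_add, neg_one_pow_congr]
      rw [Nat.even_iff, Nat.even_iff]
      omega
    rw [hsd]
    linear_combination (xV F n t ^ q ^ c * subDet F q n C (range m \ S)) * hsign

theorem detExpansion_eq {q : ℕ} (hq : q ≠ 0) (m : ℕ) (C : Finset ℕ) :
    detExpansion F q n m C =
      contrSet (frobCoord F q n) C (detExpansion F q n m ∅) := by
  induction C using Finset.induction_on_min with
  | empty => simp [contrSet, contrList_nil]
  | insert a S ha ih =>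
    have hs : (insert a S).sort (· ≤ ·) = a :: S.sort (· ≤ ·) :=
      Finset.sort_insert _ (fun s hs => (ha s hs).le) fun h => lt_irrefl _ (ha a h)
    rw [contrSet, hs, contrList_cons, Module.End.mul_apply, ← contr_detExpansion hq m ha, ih]
    rfl

theorem detExpansion_empty (q m : ℕ) :
    detExpansion F q n m ∅ = ((-1) ^ (∑ s ∈ range m, s) : SV F n) • extMon F n (range m) := by
  rw [detExpansion, sum_eq_single (range m)]
  · have : subDet F q n ∅ ∅ = 1 := by
      rw [subDet_eq_det (R := ∅) (T := ∅) q (Fin.elim0 : Fin 0 → ℕ) Fin.elim0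
          (fun i => i.elim0) (fun i => i.elim0)
        rfl rfl, Matrix.det_isEmpty]
    rw [Finset.sdiff_self, this, mul_one]
  · intro S hS hne
    rw [subDet_eq_zero, mul_zero, zero_smul]
    rw [card_empty, Ne, card_eq_zero, sdiff_eq_empty_iff_subset]
    exact fun h => hne ((mem_powerset.1 hS).antisymm h)
  · simp

theorem scalarPart_detExpansion (q m : ℕ) (C : Finset ℕ) :
    scalarPart F n (detExpansion F q n m C) = subDet F q n C (range m) := by
  rw [detExpansion, map_sum, sum_eq_single ∅]
  · simp [extMon_empty]
  · intro S _ hS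
    rw [map_smul, scalarPart_extMon (nonempty_iff_ne_empty.2 hS), smul_zero]
  · simp

theorem MuiM_eq (q : ℕ) {m : ℕ} {B : Finset ℕ} (hB : B ⊆ range m) :
    MuiM F q n m B = ((-1) ^ (B.card * (B.card + 1) / 2 + B.card) : SV F n) •
      detExpansion F q n m (range m \ B) := by
  have hsub : (range m).powersetCard B.card ⊆ (range m).powerset := fun S hS =>
    mem_powerset.2 (mem_powersetCard.1 hS).1
  rw [detExpansion, ← sum_subset hsub, MuiM, smul_sum]
  · refine sum_congr rfl fun S _ => ?_
    have h1 : ∀ (k : ℕ) (d : SV F n) (y : LV F n),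
        ((-1 : F) ^ k) • (d ⊗ₜ[F] y) = ((-1 : SV F n) ^ k * d) • ((1 : SV F n) ⊗ₜ[F] y) := by
      intro k d y
      rcases Nat.even_or_odd k with h | h
      · rw [h.neg_one_pow, h.neg_one_pow, one_smul, one_mul, TensorProduct.smul_tmul',
          smul_eq_mul, mul_one]
      · rw [h.neg_one_pow, h.neg_one_pow, neg_one_mul, TensorProduct.smul_tmul',
          TensorProduct.smul_tmul', neg_one_smul, smul_eq_mul, mul_one]
    rw [h1, smul_smul, extMon]
    congr 1
    ring
  · intro S hS hS'
    have hSm := mem_powerset.1 hS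
    rw [subDet_eq_zero, mul_zero, zero_smul]
    rw [card_sdiff_of_subset hSm, card_sdiff_of_subset hB]
    have h1 := card_le_card hSm
    have h2 := card_le_card hB
    have h3 : S.card ≠ B.card := fun h => hS' (mem_powersetCard.2 ⟨hSm, h⟩)
    omega

end Expansion

section MuiInvariance

variable {F : Type} [Field F] {n : ℕ}

theorem contrSet_contrSet (w : ℕ → Fin n → SV F n) (B E : Finset ℕ) (f : SL F n) :
    contrSet w B (contrSet w E f) = contrList w (B.sort (· ≤ ·) ++ E.sort (· ≤ ·)) f := by
  rw [contrList_append]; rfl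

theorem scalarPart_contrSet_MuiM_of_ne {q : ℕ} (hq : q ≠ 0) {m : ℕ} {B B' : Finset ℕ}
    (hB : B ⊆ range m) (hB' : B' ⊆ range m) (hne : B' ≠ B) :
    scalarPart F n (contrSet (frobCoord F q n) B' (MuiM F q n m B)) = 0 := by
  rw [MuiM_eq q hB, map_smul, map_smul, detExpansion_eq hq, contrSet_contrSet]
  refine (congrArg _ ?_).trans (smul_zero _)
  by_cases hd : Disjoint B' (range m \ B)
  · have hsub : B' ⊆ B := by
      intro i hi
      by_contra hiB
      exact Finset.disjoint_left.1 hd hi (mem_sdiff.2 ⟨hB' hi, hiB⟩)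
    have hcard : (range m).card ≠ (B' ∪ (range m \ B)).card := by
      rw [card_union_of_disjoint hd, card_sdiff_of_subset hB]
      have h1 := card_lt_card (Finset.ssubset_iff_subset_ne.2 ⟨hsub, hne⟩)
      have h2 := card_le_card hB
      omega
    have hset : (B'.sort (· ≤ ·) ++ (range m \ B).sort (· ≤ ·)).toFinset = B' ∪ (range m \ B) := by
      simp
    have h0 : scalarPart F n (contrSet (frobCoord F q n) (B' ∪ (range m \ B))
        (detExpansion F q n m ∅)) = 0 := by
      rw [← detExpansion_eq hq, scalarPart_detExpansion, subDet_eq_zero hcard]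
    rcases contrList_eq_contrSet (frobCoord F q n)
      (B'.sort (· ≤ ·) ++ (range m \ B).sort (· ≤ ·)) with h | h | h
    · rw [h]; exact map_zero _
    · rw [h, hset, h0]
    · rw [h, hset]
      exact (map_neg _ _).trans (by rw [h0, neg_zero])
  · rw [contrList_eq_zero_of_not_nodup]
    · exact map_zero _
    · intro h
      refine hd (Finset.disjoint_left.2 fun i hi hi' => ?_)
      exact (List.nodup_append.1 h).2.2 i ((Finset.mem_sort _).2 hi) i
        ((Finset.mem_sort _).2 hi') rfl

theorem scalarPart_contrSet_MuiM {q : ℕ} (hq : q ≠ 0) {m : ℕ} {B : Finset ℕ}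
    (hB : B ⊆ range m) : ∃ ε : SV F n, ε * ε = 1 ∧
      scalarPart F n (contrSet (frobCoord F q n) B (MuiM F q n m B)) =
        ε * subDet F q n (range m) (range m) := by
  have hperm : (B.sort (· ≤ ·) ++ (range m \ B).sort (· ≤ ·)).Perm
      ((range m).sort (· ≤ ·)) := by
    refine List.perm_of_nodup_nodup_toFinset_eq (List.nodup_append.2
      ⟨Finset.sort_nodup _ _, Finset.sort_nodup _ _, fun i hi j hj hij => ?_⟩)
      (Finset.sort_nodup _ _) ?_
    · subst hij
      exact (mem_sdiff.1 ((Finset.mem_sort _).1 hj)).2 ((Finset.mem_sort _).1 hi)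
    · rw [List.toFinset_append]
      simp only [Finset.sort_toFinset, union_sdiff_of_subset hB]
  have hD : scalarPart F n (contrList (frobCoord F q n) ((range m).sort (· ≤ ·))
      (detExpansion F q n m ∅)) = subDet F q n (range m) (range m) := by
    rw [← scalarPart_detExpansion, detExpansion_eq hq m (range m)]; rfl
  have hsign : ∀ k : ℕ, ((-1) ^ k * (-1) ^ k : SV F n) = 1 := fun k => by
    rw [← mul_pow, neg_one_mul, neg_neg, one_pow]
  rw [MuiM_eq q hB, map_smul, map_smul, detExpansion_eq hq, contrSet_contrSet]
  rcases contrList_perm (frobCoord F q n) hperm with h | h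
  · rw [h, hD]
    exact ⟨_, hsign _, rfl⟩
  · refine ⟨-(-1) ^ (B.card * (B.card + 1) / 2 + B.card), by rw [neg_mul_neg, hsign], ?_⟩
    rw [h, smul_eq_mul, neg_mul, ← mul_neg, ← hD]
    exact congrArg _ (map_neg _ _)

theorem extMon_range_succ (m : ℕ) :
    extMon F n (range (m + 1)) = extMon F n (range m) * extVec (stdVec F n m) := by
  rw [extMon, extMon, yProd, yProd, Finset.sort_range, Finset.sort_range, List.range_succ,
    List.map_append, List.prod_append, List.map_singleton, List.prod_singleton, yV_eq, extVec,
    Algebra.TensorProduct.tmul_mul_tmul, one_mul]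

theorem extMon_range_mul_extVec (m : ℕ) {v : Fin n → F} (hv : ∀ s : Fin n, m ≤ s → v s = 0) :
    extMon F n (range m) * extVec v = 0 := by
  induction m generalizing v with
  | zero =>
    have : v = 0 := funext fun s => hv s (Nat.zero_le _)
    rw [this, extVec, map_zero, TensorProduct.tmul_zero, mul_zero]
  | succ m ih =>
    by_cases hm : m < n
    · have hdec : v = (v - v ⟨m, hm⟩ • stdVec F n m) + v ⟨m, hm⟩ • stdVec F n m := by abel
      have h0 := ih (v := v - v ⟨m, hm⟩ • stdVec F n m) fun s hs => by
        rcases hs.eq_or_lt with h | h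
        · have : s = ⟨m, hm⟩ := Fin.ext h.symm
          subst this
          simp [stdVec, hm]
        · have : s ≠ ⟨m, hm⟩ := fun h' => by rw [h'] at h; exact lt_irrefl _ h
          simp [stdVec, hm, this, hv s h]
      rw [extMon_range_succ, mul_assoc, hdec, extVec_add, mul_add, extVec_smul, mul_smul_comm,
        extVec_mul_self, smul_zero, add_zero, extVec_mul_swap]
      refine (mul_neg (extMon F n (range m)) _).trans ?_
      rw [← mul_assoc, h0, zero_mul, neg_zero]
    · rw [extMon_range_succ, mul_assoc]
      have : stdVec F n m = 0 := dif_neg hm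
      rw [this, extVec, map_zero, TensorProduct.tmul_zero, zero_mul, mul_zero]

theorem tAct_extMon_range {g : Matrix (Fin n) (Fin n) F} (hg : g ∈ Uset F n) (m : ℕ) :
    tAct F n g (extMon F n (range m)) = extMon F n (range m) := by
  induction m with
  | zero => rw [range_zero, extMon_empty, map_one]
  | succ m ih =>
    have hv : tAct F n g (extVec (stdVec F n m)) = extVec (g.mulVec (stdVec F n m)) :=
      twist_extVec (gAct F n g) g.mulVecLin _
    have hdec : g.mulVec (stdVec F n m) =
        (g.mulVec (stdVec F n m) - stdVec F n m) + stdVec F n m := by abel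
    rw [extMon_range_succ, map_mul, ih, hv, hdec, extVec_add, mul_add,
      extMon_range_mul_extVec, zero_add]
    intro s hs
    by_cases hm : m < n
    · have hcol : g.mulVec (stdVec F n m) s = g s ⟨m, hm⟩ := by simp [stdVec, hm]
      rw [Pi.sub_apply, hcol]
      rcases hs.eq_or_lt with h | h
      · have : s = ⟨m, hm⟩ := Fin.ext h.symm
        subst this
        simp [stdVec, hm, hg.2]
      · have : s ≠ ⟨m, hm⟩ := fun h' => by rw [h'] at h; exact lt_irrefl _ h
        simp [stdVec, hm, this, hg.1 s ⟨m, hm⟩ h]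
    · simp [stdVec, hm]

theorem smul_mem_invSL {P : Set (Matrix (Fin n) (Fin n) F)} {p : SV F n} {f : SL F n}
    (hp : p ∈ invS F n P) (hf : f ∈ invSL F n P) : p • f ∈ invSL F n P := by
  intro g hg
  have := twist_smul (gAct F n g) g.mulVecLin p f
  rw [hp g hg] at this
  exact this.trans (congrArg (p • ·) (hf g hg))

theorem scalarPart_mem_invS {P : Set (Matrix (Fin n) (Fin n) F)} {f : SL F n}
    (hf : f ∈ invSL F n P) : scalarPart F n f ∈ invS F n P := fun g hg =>
  (scalarPart_twist (gAct F n g) g.mulVecLin f).symm.trans (congrArg _ (hf g hg))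

variable [Fintype F] {q : ℕ}

theorem contrList_frobCoord_mem_invSL (hF : Fintype.card F = q)
    {P : Set (Matrix (Fin n) (Fin n) F)} {f : SL F n} (hf : f ∈ invSL F n P) (L : List ℕ) :
    contrList (frobCoord F q n) L f ∈ invSL F n P := fun g hg =>
  (twist_contrList (gAct F n g) g.mulVecLin (w' := frobCoord F q n)
    (map_pairing_frobCoord hF _ _ (gAct_linForm g)) L f).trans (congrArg _ (hf g hg))

theorem detExpansion_mem_invSL (hF : Fintype.card F = q) (m : ℕ) (C : Finset ℕ) :
    detExpansion F q n m C ∈ invSL F n (Uset F n) := by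
  have hq : q ≠ 0 := hF ▸ Fintype.card_ne_zero
  rw [detExpansion_eq hq]
  refine contrList_frobCoord_mem_invSL hF ?_ _
  rw [detExpansion_empty]
  refine smul_mem_invSL (Subalgebra.pow_mem _ (Subalgebra.neg_mem _ (Subalgebra.one_mem _)) _) ?_
  exact fun g hg => tAct_extMon_range hg m

theorem MuiM_mem_invSL (hF : Fintype.card F = q) {m : ℕ} {B : Finset ℕ} (hB : B ⊆ range m) :
    MuiM F q n m B ∈ invSL F n (Uset F n) := by
  rw [MuiM_eq q hB]
  exact smul_mem_invSL (Subalgebra.pow_mem _ (Subalgebra.neg_mem _ (Subalgebra.one_mem _)) _)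
    (detExpansion_mem_invSL hF m _)

theorem subDet_range_mem_invS (hF : Fintype.card F = q) (m : ℕ) :
    subDet F q n (range m) (range m) ∈ invS F n (Uset F n) := by
  rw [← scalarPart_detExpansion]
  exact scalarPart_mem_invS (detExpansion_mem_invSL hF m _)

end MuiInvariance

section Divisibility

variable {F : Type} [Field F] {n : ℕ}

theorem transvection_mem_Uset {t s : Fin n} (h : t < s) :
    Matrix.transvection t s (1 : F) ∈ Uset F n := by
  refine ⟨fun a b hab => ?_, fun a => ?_⟩
  · rw [Matrix.transvection, Matrix.add_apply, Matrix.one_apply_ne hab.ne',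
      Matrix.single_apply, if_neg, add_zero]
    rintro ⟨rfl, rfl⟩
    exact lt_asymm h hab
  · rw [Matrix.transvection, Matrix.add_apply, Matrix.one_apply_eq, Matrix.single_apply, if_neg,
      add_zero]
    rintro ⟨rfl, rfl⟩
    exact lt_irrefl _ h

theorem transvection_mulVec (t s : Fin n) (v : Fin n → F) :
    (Matrix.transvection t s (1 : F)).mulVec v = v + v s • Pi.single t 1 := by
  rw [Matrix.transvection, Matrix.add_mulVec, Matrix.one_mulVec]
  congr 1
  ext i
  simp [Matrix.mulVec, dotProduct, Matrix.single_apply, Pi.single_apply, ite_and, eq_comm]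

theorem killVar_linForm_single_add (t : Fin n) (v : Fin n → F) (c : F) :
    killVar F t (linForm (v + c • Pi.single t 1)) = killVar F t (linForm v) := by
  simp only [linForm_eq, map_sum, map_mul, killVar, aeval_X, aeval_C]
  refine sum_congr rfl fun s _ => ?_
  by_cases h : s = t
  · simp [h]
  · simp [h]

theorem killVar_gAct_transvection (t s : Fin n) (p : SV F n) :
    killVar F t (gAct F n (Matrix.transvection t s 1) p) = killVar F t p := by
  have : (killVar F t).comp (gAct F n (Matrix.transvection t s 1)) = killVar F t := by
    refine MvPolynomial.algHom_ext fun i => ?_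
    rw [AlgHom.comp_apply, ← linForm_single, gAct_linForm, transvection_mulVec,
      killVar_linForm_single_add]
  exact congrArg (fun φ => φ p) this

/-- Modulo `x_t`, a transvection acts as `1 + y_t ∂_s`. -/
theorem twist_killVar_transvection (t s : Fin n) (f : SL F n) :
    twist (killVar F t) LinearMap.id (tAct F n (Matrix.transvection t s 1) f) =
      twist (killVar F t) LinearMap.id f + extVec (Pi.single t 1) *
        contr (Pi.single s 1) (twist (killVar F t) LinearMap.id f) := by
  induction f using SL_induction with
  | scalar p =>
    have : tAct F n (Matrix.transvection t s 1) (p ⊗ₜ 1) =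
      gAct F n (Matrix.transvection t s 1) p ⊗ₜ 1 := twist_scalar _ (Matrix.mulVecLin _) p
    rw [this, twist_scalar, twist_scalar, contr_scalar, mul_zero, add_zero,
      killVar_gAct_transvection]
  | add f g hf hg => simp only [map_add, hf, hg, mul_add]; abel
  | vec_mul v f hf =>
    have : tAct F n (Matrix.transvection t s 1) (extVec v) =
      extVec (v + v s • Pi.single t 1) :=
        (twist_extVec _ (Matrix.mulVecLin _) v).trans (congrArg _ (transvection_mulVec t s v))
    have hp : pairing (Pi.single s 1 : Fin n → SV F n) v = C (v s) := by
      simp [pairing, Pi.single_apply, MvPolynomial.smul_eq_C_mul]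
    have hC : ∀ (c : F) (h : SL F n), (C c : SV F n) • h = c • h := fun c h => by
      rw [← MvPolynomial.algebraMap_eq, algebraMap_smul]
    set y : SL F n := extVec (Pi.single t 1) with hy
    set f' := twist (killVar F t) LinearMap.id f with hf'
    rw [map_mul, this, map_mul, map_mul, hf, twist_extVec, twist_extVec, LinearMap.id_apply,
      LinearMap.id_apply, contr_extVec_mul, hp, hC, extVec_add, extVec_smul, ← hy]
    have h1 : extVec v * (y * contr (Pi.single s 1) f') =
        -(y * (extVec v * contr (Pi.single s 1) f')) := by
      rw [← mul_assoc, extVec_mul_swap, ← mul_assoc]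
      exact neg_mul (y * extVec v) _
    have h2 : y * (y * contr (Pi.single s 1) f') = 0 := by
      rw [← mul_assoc, hy, extVec_mul_self, zero_mul]
    rw [add_mul, mul_add, mul_add, h1, smul_mul_assoc, smul_mul_assoc, h2, smul_zero, add_zero,
      mul_sub, mul_smul_comm]
    abel

theorem contrList_extVec_mul (w : ℕ → Fin n → SV F n) {v : Fin n → F}
    (hv : ∀ i, pairing (w i) v = 0) (L : List ℕ) (f : SL F n) :
    ∃ h, contrList w L (extVec v * f) = extVec v * h := by
  induction L with
  | nil => exact ⟨f, rfl⟩
  | cons i L ih =>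
    obtain ⟨h, hh⟩ := ih
    refine ⟨-contr (w i) h, ?_⟩
    rw [contrList_cons, Module.End.mul_apply, hh, contr_extVec_mul, hv, zero_smul, zero_sub]
    exact (mul_neg (extVec v) _).symm

variable [Fintype F] {q : ℕ}

theorem killVar_scalarPart_contrList_eq_zero (hF : Fintype.card F = q) {f : SL F n}
    (hf : f ∈ invSL F n (Uset F n)) (t : Fin n)
    (h0 : ∀ L : List ℕ, (∀ i ∈ L, i < t) → scalarPart F n (contrList (frobCoord F q n) L f) = 0)
    (L : List ℕ) : killVar F t (scalarPart F n (contrList (frobCoord F q n) L f)) = 0 := by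
  have hq : q ≠ 0 := hF ▸ Fintype.card_ne_zero
  let w : ℕ → Fin n → SV F n := fun i s => killVar F t (frobCoord F q n i s)
  have hw : ∀ i v, killVar F t (pairing (frobCoord F q n i) v) = pairing (w i) v := fun i v => by
    simp only [pairing, map_sum, map_smul, w]
  set f' := twist (killVar F t) LinearMap.id f with hf'
  have hkill : ∀ L, killVar F t (scalarPart F n (contrList (frobCoord F q n) L f)) =
      scalarPart F n (contrList w L f') := fun L => by
    rw [← scalarPart_twist (killVar F t) LinearMap.id,
      twist_contrList (killVar F t) LinearMap.id (w' := w) hw]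
  set y : SL F n := extVec (Pi.single t 1) with hy
  have hys : ∀ s, t < s → y * contr (Pi.single s 1) f' = 0 := fun s hs => by
    have := twist_killVar_transvection t s f
    rw [hf _ (transvection_mem_Uset hs)] at this
    exact left_eq_add.1 this
  have hwt : ∀ i, pairing (w i) (Pi.single t 1) = 0 := fun i => by
    rw [pairing_single]
    simp [w, frobCoord, killVar, hq]
  have ha : contr (Pi.single t 1) (y * f') = f' - y * contr (Pi.single t 1) f' := by
    rw [hy, contr_extVec_mul, pairing_single, Pi.single_eq_same, one_smul]
  have hscal : ∀ L, scalarPart F n (contrList w L (contr (Pi.single t 1) (y * f'))) =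
      scalarPart F n (contrList w L f') := fun L => by
    obtain ⟨h, hh⟩ := contrList_extVec_mul w hwt L (contr (Pi.single t 1) f')
    rw [ha, map_sub, map_sub, hy, hh, scalarPart_extVec_mul, sub_zero]
  have hzero : contr (Pi.single t 1) (y * f') = 0 := by
    refine eq_zero_of_scalarPart_contrList_eq_zero t t.2.le w ?_ _ (fun s hs => ?_) fun L hL => ?_
    · have : (Matrix.of fun i j : Fin t => w i (Fin.castLE t.2.le j)) =
          Matrix.of fun i j : Fin t => frobCoord F q n i (Fin.castLE t.2.le j) := by
        ext1 i j
        have hj : (Fin.castLE t.2.le j : Fin n) ≠ t := fun h => by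
          have := congrArg Fin.val h
          exact j.2.ne this
        simp [w, frobCoord, killVar, hj]
      rw [this]
      exact det_frobCoord_ne_zero hF t.2.le
    · rcases hs.eq_or_lt with h | h
      · rw [← Fin.ext h, contr_contr_self]
      · have hts : t < s := h
        have h1 : contr (Pi.single s 1) (y * f') = 0 := by
          rw [hy, contr_extVec_mul, pairing_single, Pi.single_eq_of_ne hts.ne, zero_smul, ← hy,
            hys s hts, sub_zero]
        rw [contr_contr_swap, h1, map_zero, neg_zero]
    · rw [hscal, ← hkill, h0 L hL, map_zero]
  rw [hkill, ← hscal, hzero, map_zero, map_zero]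

theorem subDet_range_dvd_scalarPart (hF : Fintype.card F = q) {m : ℕ} (hm : m < n) {f : SL F n}
    (hf : f ∈ invSL F n (Uset F n))
    (h0 : ∀ L : List ℕ, (∀ i ∈ L, i < m) → scalarPart F n (contrList (frobCoord F q n) L f) = 0)
    (L : List ℕ) : subDet F q n (range (m + 1)) (range (m + 1)) ∣
      scalarPart F n (contrList (frobCoord F q n) L f) := by
  refine subDet_range_dvd hF hm (subDet_range_mem_invS hF _)
    (scalarPart_mem_invS (contrList_frobCoord_mem_invSL hF hf L)) fun t ht => ?_
  exact X_dvd_of_killVar_eq_zero (killVar_scalarPart_contrList_eq_zero hF hf t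
    (fun L hL => h0 L fun i hi => (hL i hi).trans_le (Nat.lt_succ_iff.1 ht)) L)

end Divisibility

section Basis

variable {F : Type} [Field F] {q n : ℕ}

/-- The functional `f ↦ ∂_{b_1} ⋯ ∂_{b_j} f` followed by the projection to `S(V)`. -/
def muiCoeff (F : Type) [Field F] (q n : ℕ) (B : Finset ℕ) : SL F n →ₗ[SV F n] SV F n :=
  (scalarPart F n).toLinearMap ∘ₗ contrSet (frobCoord F q n) B

theorem muiCoeff_tmul_one {B : Finset ℕ} (hB : B.Nonempty) (p : SV F n) :
    muiCoeff F q n B (p ⊗ₜ 1) = 0 := by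
  obtain ⟨b, L, hL⟩ := List.exists_cons_of_ne_nil
    (l := B.sort (· ≤ ·)) fun h => hB.ne_empty (by rw [← B.sort_toFinset (· ≤ ·), h]; rfl)
  have hperm : (b :: L).Perm (L ++ [b]) := List.perm_append_comm (l₁ := [b])
  have h0 : contrList (frobCoord F q n) (L ++ [b]) (p ⊗ₜ 1) = 0 := by
    rw [contrList_append]
    refine (congrArg (contrList (frobCoord F q n) L) ?_).trans (map_zero _)
    exact contr_scalar _ _
  change scalarPart F n (contrList (frobCoord F q n) (B.sort (· ≤ ·)) (p ⊗ₜ 1)) = 0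
  rw [hL]
  rcases contrList_perm (frobCoord F q n) hperm with h | h <;> rw [h]
  · rw [h0, map_zero]
  · exact (congrArg _ ((congrArg Neg.neg h0).trans neg_zero)).trans (map_zero _)

theorem muiCoeff_empty_tmul_one (p : SV F n) : muiCoeff F q n ∅ (p ⊗ₜ 1) = p := by
  change scalarPart F n (contrList (frobCoord F q n) ((∅ : Finset ℕ).sort (· ≤ ·)) (p ⊗ₜ 1)) = p
  rw [Finset.sort_empty]
  exact scalarPart_scalar p

theorem scalarPart_contrList_eq_zero {L : List ℕ} {f : SL F n}
    (h : muiCoeff F q n L.toFinset f = 0) :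
    scalarPart F n (contrList (frobCoord F q n) L f) = 0 := by
  have h' : scalarPart F n (contrSet (frobCoord F q n) L.toFinset f) = 0 := h
  rcases contrList_eq_contrSet (frobCoord F q n) L with h1 | h1 | h1 <;> rw [h1]
  · exact map_zero _
  · exact h'
  · exact (map_neg (scalarPart F n) _).trans ((congrArg Neg.neg h').trans neg_zero)

theorem toFinset_subset_range {L : List ℕ} {m : ℕ} (hL : ∀ i ∈ L, i < m) :
    L.toFinset ⊆ range m := fun i hi => mem_range.2 (hL i (List.mem_toFinset.1 hi))

variable [Fintype F]

theorem eq_zero_of_muiCoeff_eq_zero (hF : Fintype.card F = q) {f : SL F n}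
    (h : ∀ B ⊆ range n, muiCoeff F q n B f = 0) : f = 0 :=
  eq_zero_of_scalarPart_contrList_eq_zero n le_rfl (frobCoord F q n)
    (det_frobCoord_ne_zero hF le_rfl) f (fun s hs => absurd s.2 (not_lt.2 hs))
    fun _ hL => scalarPart_contrList_eq_zero (h _ (toFinset_subset_range hL))

/-- The part of an invariant visible to `muiCoeff` on subsets of `{0,…,m}`, but not on subsets of
`{0,…,m-1}`, is a combination of the Mui elements `M_{m+1;b_1,…,b_j}` with `b_j = m`. -/
theorem exists_sub_sum_MuiM (hF : Fintype.card F = q) {m : ℕ} (hm : m < n) {f : SL F n}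
    (hf : f ∈ invSL F n (Uset F n)) (h0 : ∀ B ⊆ range m, muiCoeff F q n B f = 0) :
    ∃ d : Finset ℕ → SV F n, (∀ B, d B ∈ invS F n (Uset F n)) ∧
      ∀ B ⊆ range (m + 1), muiCoeff F q n B (f -
        ∑ B' ∈ (range (m + 1)).powerset with m ∈ B', d B' • MuiM F q n (m + 1) B') = 0 := by
  have hq : q ≠ 0 := hF ▸ Fintype.card_ne_zero
  have key : ∀ B, ∃ d ∈ invS F n (Uset F n), B ⊆ range (m + 1) →
      d * muiCoeff F q n B (MuiM F q n (m + 1) B) = muiCoeff F q n B f := by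
    intro B
    by_cases hB : B ⊆ range (m + 1)
    · obtain ⟨ε, hε, hM⟩ := scalarPart_contrSet_MuiM (F := F) (n := n) hq hB
      obtain ⟨e, he⟩ := subDet_range_dvd_scalarPart hF hm hf
        (fun L hL => scalarPart_contrList_eq_zero (h0 _ (toFinset_subset_range hL)))
        (B.sort (· ≤ ·))
      have hMinv : ε * subDet F q n (range (m + 1)) (range (m + 1)) ∈ invS F n (Uset F n) := by
        rw [← hM]
        exact scalarPart_mem_invS (contrList_frobCoord_mem_invSL hF (MuiM_mem_invSL hF hB) _)
      have hM0 : ε * subDet F q n (range (m + 1)) (range (m + 1)) ≠ 0 :=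
        mul_ne_zero (left_ne_zero_of_mul_eq_one hε) (subDet_range_ne_zero hF hm)
      have hfe : ε * subDet F q n (range (m + 1)) (range (m + 1)) * (ε * e) =
          muiCoeff F q n B f := by
        refine Eq.trans ?_ he.symm
        linear_combination subDet F q n (range (m + 1)) (range (m + 1)) * e * hε
      refine ⟨ε * e, mem_invS_of_mul_mem hMinv hM0 ?_, fun _ => ?_⟩
      · rw [hfe]
        exact scalarPart_mem_invS (contrList_frobCoord_mem_invSL hF hf _)
      · rw [← hfe, mul_comm]
        exact congrArg (· * _) hM
    · exact ⟨0, zero_mem _, fun h => absurd h hB⟩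
  choose d hd hdB using key
  refine ⟨d, hd, fun B hB => ?_⟩
  have hne : ∀ B' ∈ (range (m + 1)).powerset.filter (m ∈ ·), B ≠ B' →
      d B' * muiCoeff F q n B (MuiM F q n (m + 1) B') = 0 := fun B' hB' hBB' => by
    rw [mem_filter, mem_powerset] at hB'
    exact (congrArg _ (scalarPart_contrSet_MuiM_of_ne hq hB'.1 hB hBB')).trans (mul_zero _)
  rw [map_sub, map_sum]
  simp only [map_smul, smul_eq_mul]
  by_cases hmB : m ∈ B
  · rw [sum_eq_single_of_mem B (by simp [hB, hmB]) fun B' hB' h => hne B' hB' h.symm, hdB B hB,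
      sub_self]
  · rw [sum_eq_zero fun B' hB' => hne B' hB' ?_, sub_zero]
    · exact h0 B fun i hi => mem_range.2 (lt_of_le_of_ne
        (Nat.lt_succ_iff.1 (mem_range.1 (hB hi))) fun h => hmB (h ▸ hi))
    · rintro rfl
      exact hmB (mem_filter.1 hB').2

theorem exists_eq_add_sum_MuiM (hF : Fintype.card F = q) {f : SL F n}
    (hf : f ∈ invSL F n (Uset F n)) :
    ∃ c₀ ∈ invS F n (Uset F n), ∃ d : ℕ → Finset ℕ → SV F n,
      (∀ k B, d k B ∈ invS F n (Uset F n)) ∧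
      f = c₀ ⊗ₜ 1 + ∑ k ∈ range n, ∑ B ∈ (range (k + 1)).powerset with k ∈ B,
        d k B • MuiM F q n (k + 1) B := by
  have h1 : (1 : SL F n) ∈ invSL F n (Uset F n) := fun g _ => map_one (tAct F n g)
  have hsc : ∀ c ∈ invS F n (Uset F n), c ⊗ₜ[F] (1 : LV F n) ∈ invSL F n (Uset F n) := by
    intro c hc
    rw [← mul_one (c ⊗ₜ[F] (1 : LV F n)), tmul_one_mul]
    exact smul_mem_invSL hc h1
  have key : ∀ m ≤ n, ∃ c₀ ∈ invS F n (Uset F n), ∃ d : ℕ → Finset ℕ → SV F n,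
      (∀ k B, d k B ∈ invS F n (Uset F n)) ∧ ∀ B ⊆ range m, muiCoeff F q n B (f - (c₀ ⊗ₜ 1 +
        ∑ k ∈ range m, ∑ B ∈ (range (k + 1)).powerset with k ∈ B,
          d k B • MuiM F q n (k + 1) B)) = 0 := by
    intro m
    induction m with
    | zero =>
      refine fun _ => ⟨scalarPart F n f, scalarPart_mem_invS hf, 0, fun _ _ => zero_mem _, ?_⟩
      intro B hB
      rw [range_zero, subset_empty] at hB
      subst hB
      rw [range_zero, sum_empty, add_zero, map_sub, muiCoeff_empty_tmul_one, sub_eq_zero]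
      change scalarPart F n (contrList _ ((∅ : Finset ℕ).sort (· ≤ ·)) f) = _
      rw [Finset.sort_empty]
      rfl
    | succ m ih =>
      intro hm
      obtain ⟨c₀, hc₀, d, hd, h⟩ := ih (Nat.le_of_succ_le hm)
      have hsum : ∑ k ∈ range m, ∑ B ∈ (range (k + 1)).powerset with k ∈ B,
          d k B • MuiM F q n (k + 1) B ∈ invSL F n (Uset F n) := by
        refine Submodule.sum_mem _ fun k _ => Submodule.sum_mem _ fun B hB => ?_
        exact smul_mem_invSL (hd k B) (MuiM_mem_invSL hF (mem_powerset.1 (mem_filter.1 hB).1))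
      obtain ⟨e, he, h'⟩ := exists_sub_sum_MuiM hF hm (Submodule.sub_mem _ hf
        (Submodule.add_mem _ (hsc c₀ hc₀) hsum)) h
      refine ⟨c₀, hc₀, Function.update d m e, fun k B => ?_, fun B hB => ?_⟩
      · by_cases hk : k = m
        · rw [hk, Function.update_self]
          exact he B
        · rw [Function.update_of_ne hk]
          exact hd k B
      · have hupd : ∑ k ∈ range (m + 1), ∑ B ∈ (range (k + 1)).powerset with k ∈ B,
            Function.update d m e k B • MuiM F q n (k + 1) B =
            ∑ k ∈ range m, ∑ B ∈ (range (k + 1)).powerset with k ∈ B,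
              d k B • MuiM F q n (k + 1) B +
            ∑ B ∈ (range (m + 1)).powerset with m ∈ B, e B • MuiM F q n (m + 1) B := by
          rw [sum_range_succ, Function.update_self]
          refine congrArg (· + _) (sum_congr rfl fun k hk => ?_)
          rw [Function.update_of_ne (mem_range.1 hk).ne]
        rw [hupd, ← add_assoc]
        exact (congrArg _ (sub_add_eq_sub_sub _ _ _)).trans (h' B hB)
  obtain ⟨c₀, hc₀, d, hd, h⟩ := key n le_rfl
  exact ⟨c₀, hc₀, d, hd, sub_eq_zero.1 (eq_zero_of_muiCoeff_eq_zero hF h)⟩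

/-- A linear relation between `1` and Mui elements `M_{m;b_1,…,b_j}` with `b_j = m - 1` is
trivial. -/
theorem eq_zero_of_add_sum_MuiM_eq_zero (hF : Fintype.card F = q) {s : Finset (ℕ × Finset ℕ)}
    (hs : ∀ x ∈ s, x.1 ≤ n ∧ x.2 ⊆ range x.1 ∧ x.1 - 1 ∈ x.2) {c₀ : SV F n}
    {c : ℕ × Finset ℕ → SV F n}
    (h : c₀ ⊗ₜ[F] (1 : LV F n) + ∑ x ∈ s, c x • MuiM F q n x.1 x.2 = 0) :
    c₀ = 0 ∧ ∀ x ∈ s, c x = 0 := by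
  have hq : q ≠ 0 := hF ▸ Fintype.card_ne_zero
  have hΦ : ∀ B, muiCoeff F q n B (c₀ ⊗ₜ 1) +
      ∑ x ∈ s, c x * muiCoeff F q n B (MuiM F q n x.1 x.2) = 0 := fun B => by
    have := congrArg (muiCoeff F q n B) h
    simpa only [map_add, map_sum, map_smul, smul_eq_mul, map_zero] using this
  have hne : ∀ x ∈ s, ∀ B ⊆ range x.1, B ≠ x.2 →
      c x * muiCoeff F q n B (MuiM F q n x.1 x.2) = 0 := fun x hx B hB hBx =>
    (congrArg _ (scalarPart_contrSet_MuiM_of_ne hq (hs x hx).2.1 hB hBx)).trans (mul_zero _)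
  have hc₀ : c₀ = 0 := by
    have := hΦ ∅
    rwa [muiCoeff_empty_tmul_one, sum_eq_zero, add_zero] at this
    exact fun x hx => hne x hx _ (empty_subset _) fun h => notMem_empty _ (h ▸ (hs x hx).2.2)
  refine ⟨hc₀, ?_⟩
  suffices ∀ m, ∀ x ∈ s, x.1 = m → c x = 0 from fun x hx => this _ x hx rfl
  intro m
  induction m using Nat.strong_induction_on with
  | _ m ih =>
    rintro x hx rfl
    obtain ⟨hxn, hxB, hxm⟩ := hs x hx
    have := hΦ x.2
    rw [muiCoeff_tmul_one ⟨_, hxm⟩, zero_add, sum_eq_single_of_mem x hx] at this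
    · obtain ⟨ε, hε, hM⟩ := scalarPart_contrSet_MuiM (F := F) (n := n) hq hxB
      refine (mul_eq_zero.1 this).resolve_right fun h0 => ?_
      exact mul_ne_zero (left_ne_zero_of_mul_eq_one hε) (subDet_range_ne_zero hF hxn)
        (hM.symm.trans h0)
    · intro y hy hyx
      rcases lt_or_ge y.1 x.1 with hlt | hle
      · rw [ih y.1 hlt y hy rfl, zero_mul]
      · refine hne y hy _ (hxB.trans (range_subset_range.2 hle)) fun hB => hyx ?_
        have := mem_range.1 (hxB (hB ▸ (hs y hy).2.2))
        exact Prod.ext (by omega) hB.symm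

theorem sum_top_subsets {M : Type*} [AddCommMonoid M] (n : ℕ) (g : ℕ → Finset ℕ → M) :
    ∑ k ∈ range n, ∑ B ∈ (range (k + 1)).powerset with k ∈ B, g (k + 1) B =
      ∑ x ∈ (Finset.Icc 1 n ×ˢ (range n).powerset).filter
        (fun x => x.2 ⊆ range x.1 ∧ x.1 - 1 ∈ x.2), g x.1 x.2 := by
  rw [sum_sigma']
  refine sum_bij' (fun x _ => (x.1 + 1, x.2)) (fun x _ => ⟨x.1 - 1, x.2⟩) ?_ ?_ ?_ ?_ ?_
  · rintro ⟨k, B⟩ h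
    simp only [mem_sigma, mem_range, mem_filter, mem_powerset, mem_product, Finset.mem_Icc] at h ⊢
    exact ⟨⟨by omega, h.2.1.trans (range_subset_range.2 h.1)⟩, h.2.1, h.2.2⟩
  · rintro ⟨k, B⟩ h
    simp only [mem_sigma, mem_range, mem_filter, mem_powerset, mem_product, Finset.mem_Icc] at h ⊢
    rw [Nat.sub_add_cancel h.1.1.1]
    exact ⟨by omega, h.2⟩
  · rintro ⟨k, B⟩ h
    rfl
  · rintro ⟨k, B⟩ h
    simp only [mem_filter, mem_product, Finset.mem_Icc] at h
    exact Prod.ext (Nat.sub_add_cancel h.1.1.1) rfl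
  · rintro ⟨k, B⟩ h
    rfl

end Basis

/-- **Mui's theorem for `U_n(q)`** (Theorem 2.5, third part). With
`R'' = F_q[V_1, …, V_n]`, the invariants `(S(V) ⊗ Λ(V))^{U_n(q)}` form a free
`R''`-module with basis `1` together with the `M_{m;b_1,…,b_j}` for
`1 ≤ j ≤ m ≤ n` and `0 ≤ b_1 < ⋯ < b_j = m−1`; in particular
`S(V)^{U_n(q)} = F_q[V_1, …, V_n]`. -/
theorem mui_U_invariants
    (F : Type) [Field F] [Fintype F] (p r q n : ℕ)
    (hp : p.Prime) (hr : 0 < r) (hq : q = p ^ r) (hF : Fintype.card F = q) :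
    let R'' : Subalgebra F (SV F n) :=
      Algebra.adjoin F (Set.range fun a : Fin n => linProd F n a a)
    let idx : Finset (ℕ × Finset ℕ) :=
      (Finset.Icc 1 n ×ˢ (range n).powerset).filter fun x =>
        x.2 ⊆ range x.1 ∧ x.1 - 1 ∈ x.2
    (invS F n (Uset F n) = R'')
    ∧ (∀ f : SL F n, f ∈ invSL F n (Uset F n) ↔
        ∃ c₀ : SV F n, ∃ c : ℕ × Finset ℕ → SV F n,
          c₀ ∈ R'' ∧ (∀ x ∈ idx, c x ∈ R'') ∧
          f = c₀ ⊗ₜ[F] 1 + ∑ x ∈ idx, (c x ⊗ₜ[F] 1) * MuiM F q n x.1 x.2)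
    ∧ (∀ c₀ : SV F n, ∀ c : ℕ × Finset ℕ → SV F n,
        c₀ ∈ R'' → (∀ x ∈ idx, c x ∈ R'') →
        c₀ ⊗ₜ[F] 1 + ∑ x ∈ idx, (c x ⊗ₜ[F] 1) * MuiM F q n x.1 x.2 = 0 →
        c₀ = 0 ∧ ∀ x ∈ idx, c x = 0) := by
  intro R'' idx
  have hR : invS F n (Uset F n) = R'' := invS_Uset_eq_adjoin
  have hidx : ∀ x ∈ idx, x.1 ≤ n ∧ x.2 ⊆ range x.1 ∧ x.1 - 1 ∈ x.2 := fun x hx => by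
    simp only [idx, mem_filter, mem_product, Finset.mem_Icc] at hx
    exact ⟨hx.1.1.2, hx.2⟩
  refine ⟨hR, fun f => ⟨fun hf => ?_, ?_⟩, fun c₀ c _ _ h => ?_⟩
  · obtain ⟨c₀, hc₀, d, hd, h⟩ := exists_eq_add_sum_MuiM hF hf
    refine ⟨c₀, fun x => d (x.1 - 1) x.2, hR ▸ hc₀, fun x _ => hR ▸ hd _ _, ?_⟩
    simp only [tmul_one_mul]
    rw [h]
    exact congrArg _ (sum_top_subsets n fun k B => d (k - 1) B • MuiM F q n k B)
  · rintro ⟨c₀, c, hc₀, hc, rfl⟩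
    rw [← hR] at hc₀
    refine Submodule.add_mem _ ?_ (Submodule.sum_mem _ fun x hx => ?_)
    · rw [← mul_one (c₀ ⊗ₜ[F] (1 : LV F n)), tmul_one_mul]
      exact smul_mem_invSL hc₀ fun g _ => map_one (tAct F n g)
    · rw [tmul_one_mul]
      exact smul_mem_invSL (hR ▸ hc x hx) (MuiM_mem_invSL hF (hidx x hx).2.1)
  · simp only [tmul_one_mul] at h
    exact eq_zero_of_add_sum_MuiM_eq_zero hF hidx h

end
end

section
/- Fix 1 ≤ j ≤ n and suppose f = ∑_{1 ≤ i ≤ ℓ, m_i ≥ j} ∑_{0 ≤ b_1 < ⋯ < b_j ≤ m_i−1, b_j ≥ m_{i−1}} M_{m_i;b_1,…,b_j} · f_{m_i;b_1,…,b_j} in S(V)⊗Λ(V), where the f_{m_i;b_1,…,b_j} ∈ F_q[x_1,…,x_n]. Then f = 0 if and only if all f_{m_i;b_1,…,b_j} = 0; that is, the family of elements M_{m_i;b_1,…,b_j} indexed by 1 ≤ i ≤ ℓ with m_i ≥ j and sequences 0 ≤ b_1 < ⋯ < b_j ≤ m_i−1 with b_j ≥ m_{i−1} is linearly independent over F_q[x_1,…,x_n].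 -/
open scoped TensorProduct
open MvPolynomial Finset

noncomputable section

/-- The maximal minor of `A` on the columns in `S`; junk value `0` if sizes differ. -/
def colMinor {R : Type*} [CommRing R] {j m : ℕ} (A : Fin j → Fin m → R)
    (S : Finset (Fin m)) : R :=
  if h : #S = j then (Matrix.of fun i l => A i (S.orderEmbOfFin h l)).det else 0

/-- The sign of the permutation comparing a reference enumeration `e` of `Fin m` with the one
listing `S` first and then its complement, both in increasing order. -/
def shuffleSign {j k m : ℕ} (e : Fin j ⊕ Fin k ≃ Fin m) (S : Finset (Fin m)) : ℤˣ :=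
  if h : #S = j ∧ #Sᶜ = k then
    Equiv.Perm.sign (e.trans (finSumEquivOfFinset h.1 h.2).symm) else 1

lemma card_compl_of_sumEquiv {j k m : ℕ} (e : Fin j ⊕ Fin k ≃ Fin m) {S : Finset (Fin m)}
    (h : #S = j) : #Sᶜ = k := by
  have := Fintype.card_congr e
  simp only [Fintype.card_sum, Fintype.card_fin] at this
  rw [card_compl, Fintype.card_fin]
  omega

lemma shuffleSign_of_card {j k m : ℕ} (e : Fin j ⊕ Fin k ≃ Fin m) {S : Finset (Fin m)}
    (h : #S = j) : shuffleSign e S =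
      Equiv.Perm.sign (e.trans (finSumEquivOfFinset h (card_compl_of_sumEquiv e h)).symm) :=
  dif_pos ⟨h, card_compl_of_sumEquiv e h⟩

lemma of_sumElim_update {R : Type*} {j k m : ℕ} (e : Fin j ⊕ Fin k ≃ Fin m)
    (A : Fin j → Fin m → R) (B : Fin k → Fin m → R) (i : Fin j) (z : Fin m → R) :
    (Matrix.of fun r c => Sum.elim (Function.update A i z) B r (e c)) =
      (Matrix.of fun r c => Sum.elim A B r (e c)).updateRow (Sum.inl i) (z ∘ e) := by
  ext r c
  rcases r with r | r
  · rw [Matrix.updateRow_apply, Matrix.of_apply, Sum.elim_inl, Function.update_apply]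
    by_cases h : r = i
    · rw [if_pos h, if_pos (congrArg _ h), Function.comp_apply]
    · rw [if_neg h, if_neg (Sum.inl_injective.ne h), Matrix.of_apply, Sum.elim_inl]
  · rw [Matrix.updateRow_ne Sum.inr_ne_inl]
    rfl

/-- The determinant with rows `A` followed by `B`, as an alternating map in the top rows `A`. -/
def detTopAlternating {R : Type*} [CommRing R] {j k m : ℕ} (e : Fin j ⊕ Fin k ≃ Fin m)
    (B : Fin k → Fin m → R) : (Fin m → R) [⋀^Fin j]→ₗ[R] R where
  toFun A := (Matrix.of fun r c => Sum.elim A B r (e c)).det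
  map_update_add' {inst} A i x y := by
    obtain rfl : inst = instDecidableEqFin j := Subsingleton.elim _ _
    simp only [of_sumElim_update]
    exact Matrix.det_updateRow_add _ _ _ _
  map_update_smul' {inst} A i c x := by
    obtain rfl : inst = instDecidableEqFin j := Subsingleton.elim _ _
    simp only [of_sumElim_update]
    exact Matrix.det_updateRow_smul _ _ _ _
  map_eq_zero_of_eq' A i i' h hne := by
    refine Matrix.det_zero_of_row_eq (i := Sum.inl i) (j := Sum.inl i') (by simpa using hne) ?_
    ext c
    simp [h]

/-- `colMinor` as an alternating map of the rows. -/
def colMinorAlternating (R : Type*) [CommRing R] (j : ℕ) {m : ℕ} (S : Finset (Fin m)) :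
    (Fin m → R) [⋀^Fin j]→ₗ[R] R :=
  if h : #S = j then
    Matrix.detRowAlternating.compLinearMap (LinearMap.funLeft R R (S.orderEmbOfFin h)) else 0

lemma colMinorAlternating_apply {R : Type*} [CommRing R] {j m : ℕ} (S : Finset (Fin m))
    (A : Fin j → Fin m → R) : colMinorAlternating R j S A = colMinor A S := by
  unfold colMinorAlternating colMinor
  split_ifs <;> rfl

lemma colMinor_single {R : Type*} [CommRing R] {j m : ℕ} {T S : Finset (Fin m)} (hT : #T = j) :
    colMinor (fun i => (Pi.single (T.orderEmbOfFin hT i) 1 : Fin m → R)) S =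
      if S = T then 1 else 0 := by
  unfold colMinor
  split_ifs with h h' h'
  · subst h'
    convert Matrix.det_one (n := Fin j) (R := R)
    ext i l
    simp [Matrix.one_apply, Pi.single_apply, eq_comm]
  · obtain ⟨t, ht, hts⟩ : ∃ t ∈ T, t ∉ S := by
      by_contra! hc
      exact h' (eq_of_subset_of_card_le hc (by omega)).symm
    obtain ⟨i, rfl⟩ : t ∈ Set.range (T.orderEmbOfFin hT) := by simpa using ht
    refine Matrix.det_eq_zero_of_row_eq_zero i fun l => ?_
    have : S.orderEmbOfFin h l ≠ T.orderEmbOfFin hT i := fun hh =>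
      hts (hh ▸ orderEmbOfFin_mem S h l)
    simp [this]
  · exact absurd (h' ▸ hT) h
  · rfl

lemma sum_alternatingMap_apply {R M N ι α : Type*} [CommSemiring R] [AddCommMonoid M] [Module R M]
    [AddCommMonoid N] [Module R N] (s : Finset α) (f : α → M [⋀^ι]→ₗ[R] N) (v : ι → M) :
    (∑ a ∈ s, f a) v = ∑ a ∈ s, f a v :=
  map_sum (⟨⟨fun g => g v, rfl⟩, fun _ _ => rfl⟩ : (M [⋀^ι]→ₗ[R] N) →+ N) f s

/-- **Laplace expansion** of a determinant along its first `j` rows. -/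
theorem det_laplace {R : Type*} [CommRing R] {j k m : ℕ} (e : Fin j ⊕ Fin k ≃ Fin m)
    (A : Fin j → Fin m → R) (B : Fin k → Fin m → R) :
    (Matrix.of fun r c => Sum.elim A B r (e c)).det =
      ∑ S ∈ powersetCard j univ, shuffleSign e S • (colMinor A S * colMinor B Sᶜ) := by
  suffices detTopAlternating e B = ∑ S ∈ powersetCard j univ,
      ((shuffleSign e S : ℤ) * colMinor B Sᶜ) • colMinorAlternating R j S by
    refine (DFunLike.congr_fun this A).trans ?_
    rw [sum_alternatingMap_apply]
    refine sum_congr rfl fun S _ => ?_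
    rw [AlternatingMap.smul_apply, colMinorAlternating_apply, Units.smul_def, zsmul_eq_mul,
      smul_eq_mul]
    rw [mul_assoc, mul_comm (colMinor B _)]
  refine (Pi.basisFun R (Fin m)).ext_alternating fun s hs => ?_
  set T : Finset (Fin m) := univ.map ⟨s, hs⟩ with hTdef
  have hT : #T = j := by simp [hTdef]
  have hmem (i : Fin j) : s i ∈ Set.range (T.orderEmbOfFin hT) := by simp [hTdef]
  choose π hπ using hmem
  have hπi : Function.Injective π := fun a b h => hs (by rw [← hπ a, h, hπ b])
  let σ : Equiv.Perm (Fin j) := Equiv.ofBijective π (Finite.injective_iff_bijective.1 hπi)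
  have hsσ : (fun i => Pi.basisFun R (Fin m) (s i)) =
      (fun i => (Pi.single (T.orderEmbOfFin hT i) 1 : Fin m → R)) ∘ σ := by
    ext i : 1
    simp [σ, hπ]
  rw [hsσ, AlternatingMap.map_perm, AlternatingMap.map_perm]
  congr 1
  rw [sum_alternatingMap_apply, sum_eq_single_of_mem T (by simp [hT]) fun S _ hST => by
      rw [AlternatingMap.smul_apply, colMinorAlternating_apply, colMinor_single, if_neg hST,
        smul_zero],
    AlternatingMap.smul_apply, colMinorAlternating_apply, colMinor_single, if_pos rfl, smul_eq_mul,
    mul_one, shuffleSign_of_card e hT]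
  have hTc := card_compl_of_sumEquiv e hT
  have hperm := Matrix.det_permute' (e.trans (finSumEquivOfFinset hT hTc).symm)
    (Matrix.of fun r c => Sum.elim (fun i => (Pi.single (T.orderEmbOfFin hT i) 1 : Fin m → R)) B r
      (finSumEquivOfFinset hT hTc c))
  have hblock : (Matrix.of fun r c =>
      Sum.elim (fun i => (Pi.single (T.orderEmbOfFin hT i) 1 : Fin m → R)) B r
        (finSumEquivOfFinset hT hTc c)) =
      Matrix.fromBlocks 1 0 (Matrix.of fun i l => B i (T.orderEmbOfFin hT l))
        (Matrix.of fun i l => B i (Tᶜ.orderEmbOfFin hTc l)) := by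
    ext r c
    rcases r with r | r <;> rcases c with c | c
    · simp [Matrix.one_apply, Pi.single_apply, eq_comm]
    · have : Tᶜ.orderEmbOfFin hTc c ≠ T.orderEmbOfFin hT r := fun h =>
        mem_compl.1 (orderEmbOfFin_mem Tᶜ hTc c) (h ▸ orderEmbOfFin_mem T hT r)
      simp [this]
    · simp
    · simp
  rw [hblock, Matrix.det_fromBlocks_zero₁₂, Matrix.det_one, one_mul, ← hblock] at hperm
  rw [colMinor, dif_pos hTc, ← hperm]
  change Matrix.det _ = _
  congr 1
  ext r c
  simp

lemma swap_lt_swap_of_covby {m : ℕ} {a b u v : Fin m} (hab : (b : ℕ) + 1 = a) (huv : u < v)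
    (h : u ≠ b ∨ v ≠ a) : Equiv.swap a b u < Equiv.swap a b v := by
  rw [Fin.lt_def] at *
  simp only [Ne, Fin.ext_iff, Equiv.swap_apply_def] at *
  split_ifs <;> omega

lemma shuffleSign_map_swap {j k m : ℕ} (e : Fin j ⊕ Fin k ≃ Fin m) {T : Finset (Fin m)}
    (hT : #T = j) {a b : Fin m} (hab : (b : ℕ) + 1 = a) (ha : a ∈ T) (hb : b ∉ T) :
    shuffleSign e (T.map (Equiv.swap a b).toEmbedding) = - shuffleSign e T := by
  have hT' : #(T.map (Equiv.swap a b).toEmbedding) = j := by simpa using hT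
  have hTc := card_compl_of_sumEquiv e hT
  have hTc' := card_compl_of_sumEquiv e hT'
  have hne : a ≠ b := fun h => hb (h ▸ ha)
  have hinl (i : Fin j) : Equiv.swap a b (T.orderEmbOfFin hT i) =
      (T.map (Equiv.swap a b).toEmbedding).orderEmbOfFin hT' i := by
    refine congrFun (orderEmbOfFin_unique hT' (f := fun i =>
      Equiv.swap a b (T.orderEmbOfFin hT i)) (fun x => ?_) fun x y hxy => ?_) i
    · simp
    · exact swap_lt_swap_of_covby hab ((T.orderEmbOfFin hT).strictMono hxy)
        (.inl fun h => hb (h ▸ orderEmbOfFin_mem T hT x))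
  have hinr (i : Fin k) : Equiv.swap a b (Tᶜ.orderEmbOfFin hTc i) =
      (T.map (Equiv.swap a b).toEmbedding)ᶜ.orderEmbOfFin hTc' i := by
    refine congrFun (orderEmbOfFin_unique hTc' (f := fun i =>
      Equiv.swap a b (Tᶜ.orderEmbOfFin hTc i)) (fun x => ?_) fun x y hxy => ?_) i
    · have := orderEmbOfFin_mem Tᶜ hTc x
      rw [mem_compl] at this ⊢
      simpa using this
    · exact swap_lt_swap_of_covby hab ((Tᶜ.orderEmbOfFin hTc).strictMono hxy)
        (.inr fun h => mem_compl.1 (orderEmbOfFin_mem Tᶜ hTc y) (h ▸ ha))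
  have key : finSumEquivOfFinset hT' hTc' =
      (finSumEquivOfFinset hT hTc).trans (Equiv.swap a b) := by
    ext x : 1
    rcases x with i | i
    · simp [hinl]
    · simp [hinr]
  rw [shuffleSign_of_card e hT', shuffleSign_of_card e hT, key]
  have : e.trans ((finSumEquivOfFinset hT hTc).trans (Equiv.swap a b)).symm =
      ((e.trans (Equiv.swap a b)).trans e.symm).trans
        (e.trans (finSumEquivOfFinset hT hTc).symm) := by
    ext x : 1
    simp only [Equiv.trans_apply, Equiv.symm_trans_apply, Equiv.apply_symm_apply, Equiv.symm_swap]
  rw [this, Equiv.Perm.sign_trans, Equiv.Perm.sign_trans_trans_symm, Equiv.Perm.sign_swap hne]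
  simp

lemma sum_map_swap {m : ℕ} {T : Finset (Fin m)} {a b : Fin m} (hab : (b : ℕ) + 1 = a)
    (ha : a ∈ T) (hb : b ∉ T) :
    ∑ t ∈ T.map (Equiv.swap a b).toEmbedding, (t : ℕ) + 1 = ∑ t ∈ T, (t : ℕ) := by
  rw [sum_map, ← add_sum_erase T _ ha, ← add_sum_erase T _ ha]
  have : ∑ x ∈ T.erase a, ((Equiv.swap a b).toEmbedding x : ℕ) = ∑ x ∈ T.erase a, (x : ℕ) := by
    refine sum_congr rfl fun x hx => ?_
    rw [Equiv.coe_toEmbedding, Equiv.swap_apply_of_ne_of_ne (ne_of_mem_erase hx)]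
    exact fun h => hb (h ▸ mem_of_mem_erase hx)
  rw [this]
  simp
  omega

lemma isLowerSet_of_pred_mem {m : ℕ} {T : Finset (Fin m)}
    (h : ∀ a ∈ T, ∀ b : Fin m, (b : ℕ) + 1 = a → b ∈ T) : IsLowerSet (T : Set (Fin m)) := by
  have key (d : ℕ) : ∀ a ∈ T, ∀ b : Fin m, (b : ℕ) + d = a → b ∈ T := by
    induction d with
    | zero => exact fun a ha b hb => (Fin.ext hb : b = a) ▸ ha
    | succ d ih =>
      intro a ha b hb
      have := a.2
      exact ih ⟨b + d, by omega⟩ (h a ha _ (by simp; omega)) b rfl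
  exact fun a b hba ha => key (a - b) a ha b (by have : (b : ℕ) ≤ a := hba; omega)

lemma shuffleSign_mul_eq {j k m : ℕ} (e : Fin j ⊕ Fin k ≃ Fin m) (N : ℕ) :
    ∀ T T' : Finset (Fin m), #T = j → #T' = j → ∑ t ∈ T, (t : ℕ) + ∑ t ∈ T', (t : ℕ) = N →
      shuffleSign e T * (-1) ^ (∑ t ∈ T, (t : ℕ)) =
        shuffleSign e T' * (-1) ^ (∑ t ∈ T', (t : ℕ)) := by
  induction N using Nat.strong_induction_on with
  | _ N ih =>
  have step (T T' : Finset (Fin m)) (hT : #T = j) (hT' : #T' = j)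
      (hN : ∑ t ∈ T, (t : ℕ) + ∑ t ∈ T', (t : ℕ) = N)
      (h : ¬ ∀ a ∈ T, ∀ b : Fin m, (b : ℕ) + 1 = a → b ∈ T) :
      shuffleSign e T * (-1) ^ (∑ t ∈ T, (t : ℕ)) =
        shuffleSign e T' * (-1) ^ (∑ t ∈ T', (t : ℕ)) := by
    push Not at h
    obtain ⟨a, ha, b, hab, hb⟩ := h
    have hsum := sum_map_swap hab ha hb
    have := ih _ (by omega) (T.map (Equiv.swap a b).toEmbedding) T' (by simpa using hT) hT' rfl
    rw [← this, ← hsum, pow_succ, shuffleSign_map_swap e hT hab ha hb]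
    simp
  intro T T' hT hT' hN
  by_cases h : ∀ a ∈ T, ∀ b : Fin m, (b : ℕ) + 1 = a → b ∈ T
  · by_cases h' : ∀ a ∈ T', ∀ b : Fin m, (b : ℕ) + 1 = a → b ∈ T'
    · have : T = T' := by
        rcases (isLowerSet_of_pred_mem h).total (isLowerSet_of_pred_mem h') with hs | hs
        · exact eq_of_subset_of_card_le (mod_cast hs) (by omega)
        · exact (eq_of_subset_of_card_le (mod_cast hs) (by omega)).symm
      rw [this]
    · exact (step T' T hT' hT (by omega) h').symm
  · exact step T T' hT hT' hN h

lemma exists_shuffleSign_eq {j k m : ℕ} (e : Fin j ⊕ Fin k ≃ Fin m) :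
    ∃ ε : ℤˣ, ∀ T : Finset (Fin m), #T = j →
      shuffleSign e T = ε * (-1) ^ (∑ t ∈ T, (t : ℕ)) := by
  by_cases h : ∃ T₀ : Finset (Fin m), #T₀ = j
  · obtain ⟨T₀, hT₀⟩ := h
    refine ⟨shuffleSign e T₀ * (-1) ^ (∑ t ∈ T₀, (t : ℕ)), fun T hT => ?_⟩
    rw [← shuffleSign_mul_eq e _ T T₀ hT hT₀ rfl, mul_assoc, ← mul_pow]
    simp
  · exact ⟨1, fun T hT => absurd ⟨T, hT⟩ h⟩

/-- The `SV`-valued functional on `V` sending `y_t` to `x_t ^ (q ^ b)`. -/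
def powFunctional (F : Type) [Field F] (q n b : ℕ) : (Fin n → F) →ₗ[F] SV F n :=
  Fintype.linearCombination F fun t => (X t : SV F n) ^ q ^ b

/-- `v ↦ det (φ_{b_k}(v_l))`, where `B = {b_1 < ⋯ < b_j}` and `φ_b` is `powFunctional`. -/
def minorAlternating (F : Type) [Field F] (q n : ℕ) (B : Finset ℕ) :
    (Fin n → F) [⋀^Fin #B]→ₗ[F] SV F n where
  toMultilinearMap :=
    ((Matrix.detRowAlternating (n := Fin #B) (R := SV F n)).toMultilinearMap.restrictScalars
      F).compLinearMap fun _ =>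
        LinearMap.pi fun k => powFunctional F q n (B.orderEmbOfFin rfl k)
  map_eq_zero_of_eq' v i i' h hne :=
    Matrix.detRowAlternating.map_eq_zero_of_eq _ (by simp only [h]) hne

/-- The `SV`-linear extension to `S(V) ⊗ Λ(V)` of `minorAlternating`. -/
def minorFunctional (F : Type) [Field F] (q n : ℕ) (B : Finset ℕ) : SL F n →ₗ[F] SV F n :=
  LinearMap.mul' F (SV F n) ∘ₗ TensorProduct.map LinearMap.id
    (ExteriorAlgebra.liftAlternating (Pi.single #B (minorAlternating F q n B)))

lemma minorFunctional_smul (F : Type) [Field F] (q n : ℕ) (B : Finset ℕ) (a : SV F n)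
    (z : SL F n) :
    minorFunctional F q n B ((a ⊗ₜ[F] (1 : LV F n)) * z) = a * minorFunctional F q n B z := by
  induction z using TensorProduct.induction_on with
  | zero => simp
  | tmul x y => simp [minorFunctional, mul_assoc]
  | add x y hx hy => rw [mul_add, map_add, map_add, hx, hy, mul_add]

lemma orderEmbOfFin_map_val {m j : ℕ} {S : Finset (Fin m)} (hS : #S = j)
    (hS' : #(S.map Fin.valEmbedding) = j) (k : Fin j) :
    (S.map Fin.valEmbedding).orderEmbOfFin hS' k = (S.orderEmbOfFin hS k : ℕ) :=
  (congrFun (orderEmbOfFin_unique hS' (f := fun k => (S.orderEmbOfFin hS k : ℕ))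
    (fun x => mem_map_of_mem Fin.valEmbedding (orderEmbOfFin_mem S hS x))
    fun _ _ hxy => (S.orderEmbOfFin hS).strictMono hxy) k).symm

lemma yProd_eq_ιMulti (F : Type) [Field F] {n m j : ℕ} (hm : m ≤ n) {S : Finset (Fin m)}
    (hS : #S = j) : yProd F n (S.map Fin.valEmbedding) =
      ExteriorAlgebra.ιMulti F j fun k =>
        (Pi.single (Fin.castLE hm (S.orderEmbOfFin hS k)) 1 : Fin n → F) := by
  have hS' : #(S.map Fin.valEmbedding) = j := by simpa using hS
  rw [yProd, ExteriorAlgebra.ιMulti_apply, ← listMap_orderEmbOfFin_finRange _ hS', List.map_map,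
    List.ofFn_eq_map]
  congr 1
  refine List.map_congr_left fun k _ => ?_
  have hlt := (S.orderEmbOfFin hS k).2.trans_le hm
  rw [Function.comp_apply, orderEmbOfFin_map_val hS hS', yV, dif_pos hlt]
  rfl

lemma subDet_map_val (F : Type) [Field F] (q n : ℕ) {m : ℕ} (R : Finset ℕ) (S : Finset (Fin m)) :
    subDet F q n R (S.map Fin.valEmbedding) =
      colMinor (fun i t => xV F n t ^ q ^ (R.orderEmbOfFin rfl i : ℕ)) S := by
  have hc : #(S.map Fin.valEmbedding) = #S := card_map _
  by_cases h : #S = #R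
  · rw [subDet, colMinor, dif_pos h, dif_pos (hc.trans h)]
    congr 2
    ext1 i
    ext1 k
    rw [orderEmbOfFin_map_val h (hc.trans h)]
  · rw [subDet, colMinor, dif_neg h, dif_neg (by rwa [hc])]

lemma minorFunctional_tmul_yProd (F : Type) [Field F] (q : ℕ) {n m : ℕ} (hm : m ≤ n)
    (B : Finset ℕ) (a : SV F n) {S : Finset (Fin m)} (hS : #S = #B) :
    minorFunctional F q n B (a ⊗ₜ[F] yProd F n (S.map Fin.valEmbedding)) =
      a * subDet F q n B (S.map Fin.valEmbedding) := by
  rw [yProd_eq_ιMulti F hm hS, minorFunctional, LinearMap.comp_apply, TensorProduct.map_tmul,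
    LinearMap.mul'_apply, ExteriorAlgebra.liftAlternating_apply_ιMulti, Pi.single_eq_same,
    subDet_map_val, colMinor, dif_pos hS, LinearMap.id_apply]
  congr 1
  rw [← Matrix.det_transpose]
  change Matrix.det _ = _
  congr 1
  ext i k : 2
  have hlt := (S.orderEmbOfFin hS i).2.trans_le hm
  simp [powFunctional, Fintype.linearCombination_apply, Matrix.transpose, xV, hlt,
    Pi.single_apply, Fin.castLE]

/-- Generalized Moore determinants with distinct exponents do not vanish. -/
lemma det_X_pow_ne_zero (F : Type) [Field F] {q n m : ℕ} (hq : 2 ≤ q) (hm : m ≤ n)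
    {ι : Type*} [Fintype ι] [DecidableEq ι] (e : ι ≃ Fin m) {ρ : ι → ℕ}
    (hρ : Function.Injective ρ) :
    (Matrix.of fun r c : ι => xV F n (e c) ^ q ^ ρ r).det ≠ 0 := by
  let u (c : ι) : Fin n := Fin.castLE hm (e c)
  have hu : Function.Injective u := (Fin.castLE_injective hm).comp e.injective
  have hx (c : ι) : xV F n (e c) = X (u c) := by
    rw [xV, dif_pos ((e c).2.trans_le hm)]; rfl
  let w (σ : Equiv.Perm ι) : Fin n →₀ ℕ := ∑ c, Finsupp.single (u c) (q ^ ρ (σ c))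
  have hw (σ : Equiv.Perm ι) (c : ι) : w σ (u c) = q ^ ρ (σ c) := by
    simp [w, Finsupp.finsetSum_apply, Finsupp.single_apply, hu.eq_iff]
  have hw1 (σ : Equiv.Perm ι) : w σ = w 1 ↔ σ = 1 := by
    refine ⟨fun h => Equiv.ext fun c => hρ (Nat.pow_right_injective hq ?_), fun h => h ▸ rfl⟩
    simpa only [hw] using DFunLike.congr_fun h (u c)
  have hdet : (Matrix.of fun r c : ι => xV F n (e c) ^ q ^ ρ r).det =
      ∑ σ : Equiv.Perm ι, Equiv.Perm.sign σ • monomial (w σ) (1 : F) := by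
    rw [Matrix.det_apply]
    refine sum_congr rfl fun σ _ => ?_
    congr 1
    simp only [Matrix.of_apply, hx, X_pow_eq_monomial, w]
    exact (monomial_sum_one _ _).symm
  intro h0
  have hcoeff := congrArg (coeff (w 1)) (hdet.symm.trans h0)
  have hterm (σ : Equiv.Perm ι) : coeff (w 1) (Equiv.Perm.sign σ • monomial (w σ) (1 : F)) =
      if σ = 1 then 1 else 0 := by
    rw [Units.smul_def, zsmul_eq_mul, ← map_intCast (C : F →+* SV F n), coeff_C_mul, coeff_monomial]
    simp only [hw1]
    split_ifs with h <;> simp [h]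
  simp [coeff_sum, hterm] at hcoeff

lemma minorFunctional_MuiM (F : Type) [Field F] (q : ℕ) {n m : ℕ} (hm : m ≤ n)
    {B B' : Finset ℕ} (hcard : #B = #B') (hB' : B' ⊆ range m) :
    ∃ (ε : ℤˣ) (e : Fin #B ⊕ Fin #(range m \ B') ≃ Fin m),
      minorFunctional F q n B (MuiM F q n m B') = ε • (Matrix.of fun r c => xV F n (e c) ^ q ^
        (Sum.elim (B.orderEmbOfFin rfl) ((range m \ B').orderEmbOfFin rfl) r : ℕ)).det := by
  have hcards : #B + #(range m \ B') = m := by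
    have := card_le_card hB'
    rw [card_sdiff_of_subset hB', hcard]
    rw [card_range] at *
    omega
  let e : Fin #B ⊕ Fin #(range m \ B') ≃ Fin m := finSumFinEquiv.trans (finCongr hcards)
  obtain ⟨ε, hε⟩ := exists_shuffleSign_eq e
  have hlap := det_laplace e
    (fun i t => xV F n t ^ q ^ (B.orderEmbOfFin rfl i : ℕ))
    (fun i t => xV F n t ^ q ^ ((range m \ B').orderEmbOfFin rfl i : ℕ))
  have hmat : (Matrix.of fun r c => xV F n (e c) ^ q ^
        (Sum.elim (B.orderEmbOfFin rfl) ((range m \ B').orderEmbOfFin rfl) r : ℕ)) =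
      Matrix.of fun r c => Sum.elim
        (fun i (t : Fin m) => xV F n t ^ q ^ (B.orderEmbOfFin rfl i : ℕ))
        (fun i t => xV F n t ^ q ^ ((range m \ B').orderEmbOfFin rfl i : ℕ)) r (e c) := by
    ext r c : 2
    rcases r with r | r <;> rfl
  have hr : range m = (univ : Finset (Fin m)).map Fin.valEmbedding := by
    rw [Fin.map_valEmbedding_univ, Nat.Iio_eq_range]
  have hps : powersetCard #B' (range m) =
      (powersetCard #B (univ : Finset (Fin m))).map (mapEmbedding Fin.valEmbedding).toEmbedding := by
    rw [hr, powersetCard_map, hcard]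
  have hcompl (S : Finset (Fin m)) :
      range m \ S.map Fin.valEmbedding = Sᶜ.map Fin.valEmbedding := by
    rw [hr, ← Finset.map_sdiff, ← compl_eq_univ_sdiff]
  refine ⟨(-1) ^ (#B' * (#B' + 1) / 2 + #B') * ε, e, ?_⟩
  rw [hmat, hlap, smul_sum, MuiM, map_sum, hps, sum_map]
  refine sum_congr rfl fun S hS => ?_
  have hS : #S = #B := (mem_powersetCard.1 hS).2
  rw [RelEmbedding.coe_toEmbedding, mapEmbedding_apply, map_smul,
    minorFunctional_tmul_yProd F q hm _ _ hS, hε S hS, hcompl, subDet_map_val, subDet_map_val,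
    sum_map, smul_smul, mul_comm (colMinor _ S), ← mul_assoc, mul_assoc _ ε ε]
  simp [Units.smul_def, Algebra.smul_def, pow_add]
  exact .inl (by ring)

lemma minorFunctional_MuiM_of_ne (F : Type) [Field F] (q : ℕ) {n m : ℕ} (hm : m ≤ n)
    {B B' : Finset ℕ} (hcard : #B = #B') (hB : B ⊆ range m) (hB' : B' ⊆ range m) (hne : B ≠ B') :
    minorFunctional F q n B (MuiM F q n m B') = 0 := by
  obtain ⟨ε, e, h⟩ := minorFunctional_MuiM F q hm hcard hB'
  obtain ⟨b, hb, hb'⟩ : ∃ b ∈ B, b ∉ B' := by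
    by_contra! hc
    exact hne (eq_of_subset_of_card_le hc hcard.ge)
  obtain ⟨i, hi⟩ : b ∈ Set.range (B.orderEmbOfFin rfl) := by simpa using hb
  obtain ⟨i', hi'⟩ : b ∈ Set.range ((range m \ B').orderEmbOfFin rfl) := by
    simpa using ⟨mem_range.1 (hB hb), hb'⟩
  rw [h, Matrix.det_zero_of_row_eq (i := Sum.inl i) (j := Sum.inr i') Sum.inl_ne_inr, smul_zero]
  ext1 c
  simp only [Matrix.of_apply, Sum.elim_inl, Sum.elim_inr, hi, hi']

lemma minorFunctional_MuiM_self_ne_zero (F : Type) [Field F] {q n m : ℕ} (hq : 2 ≤ q) (hm : m ≤ n)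
    {B : Finset ℕ} (hB : B ⊆ range m) : minorFunctional F q n B (MuiM F q n m B) ≠ 0 := by
  obtain ⟨ε, e, h⟩ := minorFunctional_MuiM F q hm rfl hB
  rw [h, Ne, smul_eq_zero_iff_eq]
  refine det_X_pow_ne_zero F hq hm e (Function.Injective.sumElim (RelEmbedding.injective _)
    (RelEmbedding.injective _) fun i i' hii => ?_)
  exact (mem_sdiff.1 (orderEmbOfFin_mem (range m \ B) rfl i')).2
    (hii ▸ orderEmbOfFin_mem B rfl i)

/-- **Lemma 2.7** (Minh–Tùng, Lemma 2; general `q`). For fixed `1 ≤ j ≤ n`, the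
elements `M_{m_i;b_1,…,b_j}` indexed by `1 ≤ i ≤ ℓ` with `m_i ≥ j` and
`0 ≤ b_1 < ⋯ < b_j ≤ m_i − 1` with `b_j ≥ m_{i−1}` are linearly independent
over `F_q[x_1,…,x_n]`. -/
theorem minh_tung_linear_independence
    (F : Type) [Field F] [Fintype F] (p r q n j : ℕ)
    (hp : p.Prime) (hr : 0 < r) (hq : q = p ^ r) (hF : Fintype.card F = q)
    (hj : 1 ≤ j) (hjn : j ≤ n) (I : Composition n)
    (g : Fin I.length × Finset ℕ → SV F n) :
    let AdmJ : Finset (Fin I.length × Finset ℕ) :=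
      (Finset.univ ×ˢ (range n).powersetCard j).filter fun x =>
        x.2 ⊆ range (I.sizeUpTo ((x.1 : ℕ) + 1)) ∧ ∃ b ∈ x.2, I.sizeUpTo (x.1 : ℕ) ≤ b
    (∑ x ∈ AdmJ, (g x ⊗ₜ[F] (1 : LV F n)) *
        MuiM F q n (I.sizeUpTo ((x.1 : ℕ) + 1)) x.2) = 0
    ↔ ∀ x ∈ AdmJ, g x = 0 := by
  intro AdmJ
  refine ⟨fun h => ?_, fun h => sum_eq_zero fun x hx => by
    rw [h x hx, TensorProduct.zero_tmul, zero_mul]⟩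
  classical
  have hq2 : 2 ≤ q := hF ▸ Fintype.one_lt_card
  by_contra! hbad
  obtain ⟨x, hx, hmin⟩ := exists_min_image (AdmJ.filter fun x => g x ≠ 0) (fun x => x.1)
    (by obtain ⟨x, hx, hgx⟩ := hbad; exact ⟨x, mem_filter.2 ⟨hx, hgx⟩⟩)
  obtain ⟨hxA, hgx⟩ := mem_filter.1 hx
  have hAdm (y) (hy : y ∈ AdmJ) : #y.2 = j ∧ y.2 ⊆ range (I.sizeUpTo ((y.1 : ℕ) + 1)) ∧
      ∃ b ∈ y.2, I.sizeUpTo (y.1 : ℕ) ≤ b := by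
    obtain ⟨hy1, hy2⟩ := mem_filter.1 hy
    exact ⟨(mem_powersetCard.1 (mem_product.1 hy1).2).2, hy2⟩
  obtain ⟨hxj, hxB, -⟩ := hAdm x hxA
  have hΦ := congrArg (minorFunctional F q n x.2) h
  rw [map_sum, map_zero, sum_eq_single_of_mem x hxA, minorFunctional_smul] at hΦ
  · exact (mul_ne_zero hgx
      (minorFunctional_MuiM_self_ne_zero F hq2 (I.sizeUpTo_le _) hxB)) hΦ
  intro y hy hyx
  rw [minorFunctional_smul]
  by_cases hgy : g y = 0
  · rw [hgy, zero_mul]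
  have hle : (x.1 : ℕ) ≤ y.1 := hmin y (mem_filter.2 ⟨hy, hgy⟩)
  obtain ⟨hyj, hyB, b, hb, hbI⟩ := hAdm y hy
  rw [minorFunctional_MuiM_of_ne F q (I.sizeUpTo_le _) (hxj.trans hyj.symm)
    (hxB.trans (range_subset_range.2 (I.monotone_sizeUpTo (by omega)))) hyB, mul_zero]
  intro heq
  rcases hle.eq_or_lt with h1 | h1
  · exact hyx (Prod.ext (Fin.ext h1.symm) heq.symm)
  · have hbx := mem_range.1 (hxB (heq ▸ hb))
    have := I.monotone_sizeUpTo (Nat.succ_le_of_lt h1)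
    simp only [Nat.succ_eq_add_one] at this
    omega
end
end
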